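/- arXiv:math/0503367 — 2 statements merged into one kernel-verified Lean document; each statement's English description precedes it below -/
import Mathlib

section
/- Let (X, 𝒳, μ, T) be a probability measure-preserving system and let A ∈ 𝒳 with μ(A) > 0. Then for every k ∈ ℕ there exists n ∈ ℕ, n ≥ 1, such that μ(A ∩ T⁻ⁿA ∩ T⁻²ⁿA ∩ ⋯ ∩ T⁻ᵏⁿA) > 0. -/
open MeasureTheory

namespace DensityHalesJewett

open Finset Combinatorics
open scoped BigOperators

/-! ### Averages over finite types -/

section Average

variable {X Y : Type} [Finite X] [Finite Y]

/-- The average of a real function over a finite type. -/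
noncomputable def avg (f : X → ℝ) : ℝ :=
  letI := Fintype.ofFinite X
  𝔼 x, f x

/-- The density of a subset of a finite type. -/
noncomputable def dens (A : Set X) : ℝ := avg (A.indicator 1)

lemma avg_eq_expect [Fintype X] (f : X → ℝ) : avg f = 𝔼 x, f x := by
  unfold avg
  congr!

@[simp] lemma avg_const [Nonempty X] (a : ℝ) : avg (fun _ : X ↦ a) = a := by
  have := Fintype.ofFinite X
  simp [avg_eq_expect]

lemma avg_mono {f g : X → ℝ} (h : ∀ x, f x ≤ g x) : avg f ≤ avg g := by
  have := Fintype.ofFinite X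
  simpa only [avg_eq_expect] using expect_le_expect fun x _ ↦ h x

lemma avg_nonneg {f : X → ℝ} (h : ∀ x, 0 ≤ f x) : 0 ≤ avg f := by
  have := Fintype.ofFinite X
  simpa only [avg_eq_expect] using expect_nonneg fun x _ ↦ h x

lemma avg_add (f g : X → ℝ) : avg (fun x ↦ f x + g x) = avg f + avg g := by
  have := Fintype.ofFinite X
  simp only [avg_eq_expect, expect_add_distrib]

lemma avg_sub (f g : X → ℝ) : avg (fun x ↦ f x - g x) = avg f - avg g := by
  have := Fintype.ofFinite X
  simp only [avg_eq_expect, expect_sub_distrib]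

lemma avg_mul_left (a : ℝ) (f : X → ℝ) : avg (fun x ↦ a * f x) = a * avg f := by
  have := Fintype.ofFinite X
  simp only [avg_eq_expect, mul_expect]

lemma avg_sum {I : Type} (s : Finset I) (f : I → X → ℝ) :
    avg (fun x ↦ ∑ i ∈ s, f i x) = ∑ i ∈ s, avg (f i) := by
  have := Fintype.ofFinite X
  simp only [avg_eq_expect, expect_sum_comm]

lemma avg_equiv (e : X ≃ Y) (f : Y → ℝ) : avg (fun x ↦ f (e x)) = avg f := by
  have := Fintype.ofFinite X
  have := Fintype.ofFinite Y
  simp only [avg_eq_expect]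
  exact Fintype.expect_equiv e _ _ fun _ ↦ rfl

lemma avg_prod (f : X × Y → ℝ) : avg f = avg fun y ↦ avg fun x ↦ f (x, y) := by
  have := Fintype.ofFinite X
  have := Fintype.ofFinite Y
  simp only [avg_eq_expect, ← univ_product_univ]
  rw [expect_product, expect_comm]

lemma avg_comm (f : X → Y → ℝ) :
    (avg fun x ↦ avg fun y ↦ f x y) = avg fun y ↦ avg fun x ↦ f x y := by
  have := Fintype.ofFinite X
  have := Fintype.ofFinite Y
  simp only [avg_eq_expect]
  rw [expect_comm]

lemma exists_le_avg [Nonempty X] (f : X → ℝ) : ∃ x, avg f ≤ f x := by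
  have := Fintype.ofFinite X
  obtain ⟨x, -, hx⟩ := exists_le_of_le_expect (s := univ) (f := f) univ_nonempty le_rfl
  exact ⟨x, by simpa only [avg_eq_expect] using hx⟩

lemma avg_eq_sum_div [Fintype X] (f : X → ℝ) : avg f = (∑ x, f x) / Nat.card X := by
  rw [avg_eq_expect, Fintype.expect_eq_sum_div_card, Nat.card_eq_fintype_card]

/-- The average of a function over the range of an injection, relative to the whole space. -/
lemma avg_indicator_range [Nonempty X] {φ : X → Y} (hφ : φ.Injective) (g : Y → ℝ) :
    avg ((Set.range φ).indicator g) = (Nat.card X / Nat.card Y : ℝ) * avg fun x ↦ g (φ x) := by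
  classical
  have := Fintype.ofFinite X
  have := Fintype.ofFinite Y
  have hX : (Nat.card X : ℝ) ≠ 0 := by exact_mod_cast Nat.card_pos.ne'
  have : ∑ y, (Set.range φ).indicator g y = ∑ x, g (φ x) := by
    rw [← sum_image (s := univ) (g := φ) (f := g) hφ.injOn,
      ← sum_indicator_subset g (subset_univ (univ.image φ)), coe_image, coe_univ, Set.image_univ]
  rw [avg_eq_sum_div, avg_eq_sum_div, this]
  field_simp

/-- The average of a product function over a finite power. -/
lemma avg_pi_prod {ι : Type} [Fintype ι] (g : X → ℝ) :
    avg (fun x : ι → X ↦ ∏ i, g (x i)) = avg g ^ Nat.card ι := by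
  classical
  have := Fintype.ofFinite X
  rw [avg_eq_sum_div, avg_eq_sum_div, div_pow, ← Fintype.piFinset_univ,
    sum_prod_piFinset univ fun _ ↦ g, prod_const]
  simp

lemma dens_nonneg (A : Set X) : 0 ≤ dens A :=
  avg_nonneg fun x ↦ Set.indicator_nonneg (fun _ _ ↦ zero_le_one) x

lemma dens_le_one [Nonempty X] (A : Set X) : dens A ≤ 1 := by
  refine (avg_mono (g := fun _ ↦ 1) fun x ↦ ?_).trans (avg_const 1).le
  exact Set.indicator_le_self' (fun _ _ ↦ zero_le_one) x

lemma nonempty_of_dens_pos {A : Set X} (h : 0 < dens A) : A.Nonempty := by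
  by_contra hA
  rw [Set.not_nonempty_iff_eq_empty] at hA
  subst hA
  have := Fintype.ofFinite X
  simp [dens, avg_eq_expect] at h

/-- If every point of a dense set satisfies one of finitely many properties, then one of these
properties holds on a dense set. -/
lemma exists_dens_le_of_forall_exists {I : Type} [Finite I] [Nonempty I] (G : Set X) (R : I → Set X)
    (h : ∀ x ∈ G, ∃ i, x ∈ R i) : ∃ i, dens G / Nat.card I ≤ dens (R i) := by
  have := Fintype.ofFinite I
  have hle : dens G ≤ ∑ i, dens (R i) := by
    simp only [dens]
    rw [← avg_sum]
    refine avg_mono fun x ↦ ?_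
    by_cases hx : x ∈ G
    · obtain ⟨i, hi⟩ := h x hx
      rw [Set.indicator_of_mem hx]
      refine le_trans ?_ (single_le_sum (f := fun i ↦ (R i).indicator (1 : X → ℝ) x)
        (fun j _ ↦ Set.indicator_nonneg (fun _ _ ↦ zero_le_one) x) (mem_univ i))
      simp [hi]
    · rw [Set.indicator_of_notMem hx]
      exact sum_nonneg fun j _ ↦ Set.indicator_nonneg (fun _ _ ↦ zero_le_one) x
  by_contra! hlt
  have : ∑ i, dens (R i) < ∑ _i : I, dens G / Nat.card I :=
    sum_lt_sum_of_nonempty univ_nonempty fun i _ ↦ hlt i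
  rw [sum_const, card_univ, nsmul_eq_mul, ← Nat.card_eq_fintype_card] at this
  have hI : (Nat.card I : ℝ) ≠ 0 := by exact_mod_cast Nat.card_pos.ne'
  rw [mul_div_cancel₀ _ hI] at this
  linarith

/-- A function bounded by one exceeds half of its average on a dense set. -/
lemma half_le_dens [Nonempty X] {f : X → ℝ} {δ : ℝ} (hf : ∀ x, f x ≤ 1) (h0 : 0 ≤ δ)
    (h : δ ≤ avg f) : δ / 2 ≤ dens {x | δ / 2 ≤ f x} := by
  have : avg f ≤ avg fun x ↦ {x | δ / 2 ≤ f x}.indicator 1 x + δ / 2 := avg_mono fun x ↦ by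
    by_cases hx : δ / 2 ≤ f x
    · rw [Set.indicator_of_mem (by exact hx)]
      have := hf x
      simp only [Pi.one_apply]
      linarith
    · rw [Set.indicator_of_notMem (by exact hx)]
      linarith
  rw [avg_add, avg_const] at this
  change _ ≤ avg _
  linarith

end Average

section Words

variable {α κ ι ι' : Type} [Finite ι'] [Finite α] [Finite κ] [Finite ι]

/-- Averaging over words on a disjoint union of two index sets. -/
lemma avg_words (e : κ ⊕ ι' ≃ ι) (f : (ι → α) → ℝ) :
    avg f = avg fun z : ι' → α ↦ avg fun y : κ → α ↦ f (Sum.elim y z ∘ e.symm) := by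
  rw [← avg_equiv (e.arrowCongr (Equiv.refl α)),
    ← avg_equiv (Equiv.sumArrowEquivProdArrow κ ι' α).symm,
    avg_prod]
  rfl

lemma dens_words (e : κ ⊕ ι' ≃ ι) (A : Set (ι → α)) :
    dens A = avg fun z : ι' → α ↦ dens {y : κ → α | Sum.elim y z ∘ e.symm ∈ A} :=
  avg_words e _

lemma dens_words' (e : κ ⊕ ι' ≃ ι) (A : Set (ι → α)) :
    dens A = avg fun y : κ → α ↦ dens {z : ι' → α | Sum.elim y z ∘ e.symm ∈ A} := by
  rw [dens_words e]
  exact avg_comm _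

variable (κ ι) in
/-- Split off a prescribed number of coordinates. -/
lemma exists_sum_equiv (h : Nat.card κ ≤ Nat.card ι) :
    ∃ ι' : Type, Finite ι' ∧ Nat.card ι = Nat.card κ + Nat.card ι' ∧ Nonempty (κ ⊕ ι' ≃ ι) := by
  refine ⟨Fin (Nat.card ι - Nat.card κ), inferInstance, by simp; omega, Finite.card_eq.1 ?_⟩
  rw [Nat.card_sum, Nat.card_fin]
  omega

end Words

/-! ### Operations on combinatorial subspaces -/

section Subspaces

variable {ι' α η θ ι κ : Type}

/-- Composition of combinatorial subspaces. -/
def subspaceComp (V : Subspace η α ι) (W : Subspace θ α η) : Subspace θ α ι where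
  idxFun i := (V.idxFun i).elim Sum.inl W.idxFun
  proper e := by
    obtain ⟨j, hj⟩ := W.proper e
    obtain ⟨i, hi⟩ := V.proper j
    exact ⟨i, by simp [hi, hj]⟩

@[simp] lemma subspaceComp_apply (V : Subspace η α ι) (W : Subspace θ α η) (x : θ → α) :
    subspaceComp V W x = V (W x) := by
  ext i
  cases h : V.idxFun i <;> simp [subspaceComp, Subspace.apply_def, h]

/-- A combinatorial subspace over `α`, viewed as a subspace over `Option α`. -/
def subspaceOption (V : Subspace η α ι) : Subspace η (Option α) ι where
  idxFun i := (V.idxFun i).map some id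
  proper e := by
    obtain ⟨i, hi⟩ := V.proper e
    exact ⟨i, by simp [hi]⟩

lemma subspaceOption_some (V : Subspace η α ι) (x : η → α) :
    (subspaceOption V fun i ↦ some (x i)) = fun i ↦ some (V x i) := by
  ext1 i
  cases h : V.idxFun i <;> simp [subspaceOption, Subspace.apply_def, h]

lemma subspaceOption_getD (V : Subspace η α ι) (x : η → Option α) (a : α) :
    (fun i ↦ (subspaceOption V x i).getD a) = V fun i ↦ (x i).getD a := by
  ext1 i
  cases h : V.idxFun i <;> simp [subspaceOption, Subspace.apply_def, h]

lemma subspaceOption_comp (V : Subspace η α ι) (W : Subspace θ α η) :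
    subspaceOption (subspaceComp V W) = subspaceComp (subspaceOption V) (subspaceOption W) := by
  ext1
  funext i
  cases h : V.idxFun i <;> simp [subspaceOption, subspaceComp, h]

/-- The value of a subspace over `Option α` at a word, up to identifying `none` with `a`, depends on
this word only up to this identification. -/
lemma getD_apply_eq (V : Subspace η (Option α) ι) {a : α} {x y : η → Option α}
    (h : ∀ i, (x i).getD a = (y i).getD a) (i : ι) : (V x i).getD a = (V y i).getD a := by
  cases hi : V.idxFun i <;> simp [Subspace.apply_def, hi, h]

/-- Extend a subspace by constant coordinates. -/
def subspaceExtend (V : Subspace η α κ) (z : ι' → α) (e : κ ⊕ ι' ≃ ι) : Subspace η α ι where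
  idxFun i := Sum.elim V.idxFun (Sum.inl ∘ z) (e.symm i)
  proper j := by
    obtain ⟨i, hi⟩ := V.proper j
    exact ⟨e (Sum.inl i), by simp [hi]⟩

@[simp] lemma subspaceExtend_apply (V : Subspace η α κ) (z : ι' → α) (e : κ ⊕ ι' ≃ ι) (x : η → α) :
    subspaceExtend V z e x = Sum.elim (V x) z ∘ e.symm := by
  ext i
  cases h : e.symm i <;> simp [subspaceExtend, Subspace.apply_def, h]

/-- The product of two subspaces. -/
def subspaceProd (V : Subspace η α κ) (W : Subspace θ α ι') (e : κ ⊕ ι' ≃ ι) :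
    Subspace (η ⊕ θ) α ι where
  idxFun i := Sum.elim (Sum.map id Sum.inl ∘ V.idxFun) (Sum.map id Sum.inr ∘ W.idxFun) (e.symm i)
  proper j := by
    rcases j with j | j
    · obtain ⟨i, hi⟩ := V.proper j
      exact ⟨e (Sum.inl i), by simp [hi]⟩
    · obtain ⟨i, hi⟩ := W.proper j
      exact ⟨e (Sum.inr i), by simp [hi]⟩

@[simp] lemma subspaceProd_apply (V : Subspace η α κ) (W : Subspace θ α ι') (e : κ ⊕ ι' ≃ ι)
    (x : η ⊕ θ → α) :
    subspaceProd V W e x = Sum.elim (V (x ∘ Sum.inl)) (W (x ∘ Sum.inr)) ∘ e.symm := by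
  ext i
  rcases h : e.symm i with j | j
  · cases h' : V.idxFun j <;> simp [subspaceProd, Subspace.apply_def, h, h']
  · cases h' : W.idxFun j <;> simp [subspaceProd, Subspace.apply_def, h, h']

lemma subspace_injective (V : Subspace η α ι) : Function.Injective (V : (η → α) → ι → α) := by
  intro x y h
  ext j
  obtain ⟨i, hi⟩ := V.proper j
  simpa [Subspace.apply_inr hi] using congrFun h i

/-- The image of a line under a combinatorial subspace. -/
def subspaceLine (V : Subspace η α ι) (l : Line α η) : Line α ι where
  idxFun i := (V.idxFun i).elim some l.idxFun
  proper := by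
    obtain ⟨j, hj⟩ := l.proper
    obtain ⟨i, hi⟩ := V.proper j
    exact ⟨i, by simp [hi, hj]⟩

@[simp] lemma subspaceLine_apply (V : Subspace η α ι) (l : Line α η) (a : α) :
    subspaceLine V l a = V (l a) := by
  ext i
  cases h : V.idxFun i <;> simp [subspaceLine, Subspace.apply_def, h]

/-- The identity subspace along an equivalence of index types. -/
def subspaceOfEquiv (e : η ≃ ι) : Subspace η α ι where
  idxFun i := Sum.inr (e.symm i)
  proper j := ⟨e j, by simp⟩

@[simp] lemma subspaceOfEquiv_apply (e : η ≃ ι) (x : η → α) :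
    subspaceOfEquiv e x = x ∘ e.symm := rfl

instance [Finite α] [Finite ι] : Finite (Line α ι) :=
  Finite.of_injective Line.idxFun fun _ _ h ↦ Line.ext h

end Subspaces

/-! ### A Graham–Rothschild theorem for lines -/

section GrahamRothschild

variable {α C : Type}

/-- A colouring of words over `Option α` has the prefix property if the colour of a word does not
depend on what comes after an occurrence of `none`. -/
def PrefixDep {M : ℕ} (c : (Fin M → Option α) → C) : Prop :=
  ∀ (w w' : Fin M → Option α) (p : Fin M), (∀ q < p, w q = w' q) → w p = none → w' p = none →
    c w = c w'

lemma exists_subspace_prefixDep [Finite α] (M : ℕ) : ∀ (C : Type) [Finite C],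
    ∃ ι : Type, Finite ι ∧ ∀ c : (ι → Option α) → C, ∃ V : Subspace (Fin M) α ι,
      PrefixDep fun w ↦ c (subspaceOption V w) := by
  induction M with
  | zero => exact fun C _ ↦ ⟨Fin 0, inferInstance, fun c ↦ ⟨default, fun _ _ p ↦ p.elim0⟩⟩
  | succ M ih =>
    intro C _
    obtain ⟨κ, _, hκ⟩ := ih (α → C)
    obtain ⟨ι, _, hι⟩ := Subspace.exists_mono_in_high_dimension (Option α) C κ
    refine ⟨Unit ⊕ ι, inferInstance, fun c ↦ ?_⟩
    obtain ⟨U, col, hU⟩ := hι fun w ↦ c (Sum.elim (fun _ ↦ none) w)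
    obtain ⟨V, hV⟩ := hκ fun w a ↦ c (Sum.elim (fun _ ↦ some a)
      fun j ↦ (U.idxFun j).elim (fun b ↦ some (b.getD a)) w)
    let W : Subspace (Fin (M + 1)) α (Unit ⊕ ι) :=
      { idxFun := Sum.elim (fun _ ↦ Sum.inr 0) fun j ↦ (U.idxFun j).elim
          (fun b ↦ b.elim (Sum.inr 0) Sum.inl) fun e ↦ (V.idxFun e).map id Fin.succ
        proper := fun p ↦ by
          refine Fin.cases ⟨Sum.inl (), rfl⟩ (fun p ↦ ?_) p
          obtain ⟨e, he⟩ := V.proper p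
          obtain ⟨j, hj⟩ := U.proper e
          exact ⟨Sum.inr j, by simp [he, hj]⟩ }
    have hW (w : Fin (M + 1) → Option α) : subspaceOption W w = Sum.elim (fun _ ↦ w 0) fun j ↦
        (U.idxFun j).elim (fun b ↦ b.elim (w 0) some) (subspaceOption V fun i ↦ w i.succ) := by
      funext i
      rcases i with i | j
      · simp [W, subspaceOption, Subspace.apply_def]
      · rcases hj : U.idxFun j with b | e
        · cases b <;> simp [W, subspaceOption, Subspace.apply_def, hj]
        · cases he : V.idxFun e <;> simp [W, subspaceOption, Subspace.apply_def, hj, he]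
    have hnone (w : Fin (M + 1) → Option α) (h : w 0 = none) : c (subspaceOption W w) = col := by
      rw [← hU (subspaceOption V fun i ↦ w i.succ), hW, h]
      congr 2
      funext j
      rcases hj : U.idxFun j with b | e
      · cases b <;> simp [Subspace.apply_def, hj]
      · simp [Subspace.apply_def, hj]
    have hsome (w : Fin (M + 1) → Option α) (a : α) (h : w 0 = some a) :
        c (subspaceOption W w) = c (Sum.elim (fun _ ↦ some a) fun j ↦ (U.idxFun j).elim
          (fun b ↦ some (b.getD a)) (subspaceOption V fun i ↦ w i.succ)) := by
      rw [hW, h]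
      congr 2
      funext j
      rcases hj : U.idxFun j with b | e
      · cases b <;> simp
      · simp
    refine ⟨W, fun w w' p ↦ ?_⟩
    refine Fin.cases (fun _ h h' ↦ ?_) (fun p hp h h' ↦ ?_) p
    · simp only [hnone _ h, hnone _ h']
    · have h0 := hp 0 (Fin.succ_pos p)
      rcases hw : w 0 with _ | a
      · simp only [hnone w hw, hnone w' (h0 ▸ hw)]
      · simp only [hsome w a hw, hsome w' a (h0 ▸ hw)]
        exact congrFun (hV (fun i ↦ w i.succ) (fun i ↦ w' i.succ) p
          (fun q hq ↦ hp q.succ (Fin.succ_lt_succ_iff.2 hq)) h h') a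

lemma exists_subspace_firstNone [Finite α] [Nonempty α] [Finite C] (m : ℕ) :
    ∃ M : ℕ, ∀ c : (Fin M → Option α) → C, PrefixDep c → ∃ V : Subspace (Fin m) α (Fin M),
      ∀ (w w' : Fin m → Option α) (p : Fin m), (∀ q < p, w q ≠ none) → (∀ q < p, w' q ≠ none) →
        w p = none → w' p = none → c (subspaceOption V w) = c (subspaceOption V w') := by
  induction m with
  | zero => exact ⟨0, fun c _ ↦ ⟨default, fun _ _ p ↦ p.elim0⟩⟩
  | succ m ih =>
    obtain ⟨M, hM⟩ := ih
    obtain ⟨b, hb⟩ := Subspace.exists_mono_in_high_dimension_fin α ((Fin M → Option α) → C) Unit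
    refine ⟨b + M, fun c hc ↦ ?_⟩
    obtain ⟨U, g, hU⟩ := hb fun u t ↦ c (Fin.append (fun i ↦ some (u i)) t)
    have hg : PrefixDep g := by
      intro w w' p hp h h'
      rw [← hU fun _ ↦ Classical.arbitrary α]
      refine hc _ _ (Fin.natAdd b p) (fun q ↦ ?_) (by simpa) (by simpa)
      refine Fin.addCases (fun i _ ↦ by simp) (fun i hi ↦ ?_) q
      simpa using hp i (by simpa using hi)
    obtain ⟨V, hV⟩ := hM g hg
    let W : Subspace (Fin (m + 1)) α (Fin (b + M)) :=
      { idxFun := Fin.append (fun i ↦ (U.idxFun i).map id fun _ ↦ 0)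
          fun j ↦ (V.idxFun j).map id Fin.succ
        proper := fun p ↦ by
          refine Fin.cases ?_ (fun p ↦ ?_) p
          · obtain ⟨i, hi⟩ := U.proper ()
            exact ⟨Fin.castAdd M i, by simp [hi]⟩
          · obtain ⟨j, hj⟩ := V.proper p
            exact ⟨Fin.natAdd b j, by simp [hj]⟩ }
    have hW (w : Fin (m + 1) → Option α) : subspaceOption W w =
        Fin.append (subspaceOption U fun _ ↦ w 0) (subspaceOption V fun i ↦ w i.succ) := by
      funext i
      refine Fin.addCases (fun i ↦ ?_) (fun j ↦ ?_) i
      · cases hi : U.idxFun i <;> simp [W, subspaceOption, Subspace.apply_def, hi]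
      · cases hj : V.idxFun j <;> simp [W, subspaceOption, Subspace.apply_def, hj]
    have hsome (w : Fin (m + 1) → Option α) (h : w 0 ≠ none) :
        c (subspaceOption W w) = g (subspaceOption V fun i ↦ w i.succ) := by
      obtain ⟨a, ha⟩ := Option.ne_none_iff_exists'.1 h
      rw [hW, ← hU fun _ ↦ a, ha, subspaceOption_some]
    refine ⟨W, fun w w' p ↦ ?_⟩
    refine Fin.cases (fun _ _ h hnone_right ↦ ?_) (fun p hp hp' h hnone_right ↦ ?_) p
    · obtain ⟨i, hi⟩ := U.proper ()
      rw [hW, hW, h, hnone_right]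
      have hnone : subspaceOption U (fun _ ↦ none) i = none := by
        simp [subspaceOption, Subspace.apply_def, hi]
      refine hc _ _ (Fin.castAdd M i) (fun q ↦ ?_) (by simpa using hnone) (by simpa using hnone)
      refine Fin.addCases (fun i _ ↦ by simp) (fun j hj ↦ ?_) q
      exact absurd hj (by simp [Fin.lt_def]; omega)
    · rw [hsome w (hp 0 (Fin.succ_pos p)), hsome w' (hp' 0 (Fin.succ_pos p))]
      exact hV _ _ p (fun q hq ↦ hp q.succ (Fin.succ_lt_succ_iff.2 hq))
        (fun q hq ↦ hp' q.succ (Fin.succ_lt_succ_iff.2 hq)) h hnone_right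

/-- The **Graham–Rothschild theorem** for lines: for every finite colouring of the lines of a
sufficiently high-dimensional cube there is an `m`-dimensional subspace all of whose lines have the
same colour. Lines are represented by words over `Option α`. -/
theorem exists_subspace_lines_mono (α : Type) [Finite α] [Nonempty α] (C : Type) [Finite C] (m : ℕ) :
    ∃ ι : Type, Finite ι ∧ ∀ c : (ι → Option α) → C, ∃ V : Subspace (Fin m) α ι, ∃ col : C,
      ∀ w : Fin m → Option α, (∃ i, w i = none) → c (subspaceOption V w) = col := by
  classical
  have := Fintype.ofFinite C
  obtain ⟨M, hM⟩ := exists_subspace_firstNone (α := α) (C := C) (Fintype.card C * m)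
  obtain ⟨ι, hι, h⟩ := exists_subspace_prefixDep (α := α) M C
  refine ⟨ι, hι, fun c ↦ ?_⟩
  have : Nonempty C := ⟨c fun _ ↦ none⟩
  obtain ⟨V, hV⟩ := h c
  obtain ⟨W, hW⟩ := hM _ hV
  let a₀ := Classical.arbitrary α
  let g (p : Fin (Fintype.card C * m)) : C :=
    c (subspaceOption V (subspaceOption W fun q ↦ if q = p then none else some a₀))
  obtain ⟨col, -, hcol⟩ := exists_le_card_fiber_of_mul_le_card_of_maps_to (s := univ) (t := univ)
    (f := g) (n := m) (by simp) univ_nonempty (by simp)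
  obtain ⟨T, hT, hTm⟩ := exists_subset_card_eq hcol
  let e : Fin m ≃ T := (Fin.castOrderIso hTm.symm).toEquiv.trans T.equivFin.symm
  let U : Subspace (Fin m) α (Fin (Fintype.card C * m)) :=
    { idxFun := fun p ↦ if h : p ∈ T then Sum.inr (e.symm ⟨p, h⟩) else Sum.inl a₀
      proper := fun i ↦ ⟨e i, by simp⟩ }
  refine ⟨subspaceComp V (subspaceComp W U), col, fun w hw ↦ ?_⟩
  have hU (q) : subspaceOption U w q = if h : q ∈ T then w (e.symm ⟨q, h⟩) else some a₀ := by
    by_cases h : q ∈ T <;> simp [U, subspaceOption, Subspace.apply_def, h]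
  have hex : ∃ p, subspaceOption U w p = none := by
    obtain ⟨i, hi⟩ := hw
    exact ⟨e i, by simp [hU, hi]⟩
  obtain ⟨p, hp, hmin⟩ := wellFounded_lt.has_min {p | subspaceOption U w p = none} hex
  have hpT : p ∈ T := by
    by_contra hpT
    simp [hU, hpT] at hp
  have hgp : g p = col := (mem_filter.1 (hT hpT)).2
  simp only [subspaceOption_comp, subspaceComp_apply]
  rw [← hgp]
  exact hW _ _ p (fun q hq hq' ↦ hmin q hq' hq) (fun q hq ↦ by simp [hq.ne]) hp (by simp)

end GrahamRothschild

/-! ### The density Hales–Jewett property and its multidimensional version -/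

/-- The density Hales–Jewett property of an alphabet: dense sets of sufficiently long words contain
a combinatorial line. -/
def DensityHJ (α : Type) [Finite α] : Prop :=
  ∀ δ : ℝ, 0 < δ → ∃ n : ℕ, ∀ (ι : Type) [Finite ι], n ≤ Nat.card ι → ∀ A : Set (ι → α),
    δ ≤ dens A → ∃ l : Line α ι, ∀ a, l a ∈ A

section Multidimensional

variable {α : Type} [Finite α]

/-- If dense sets of words over `ι` contain lines, then for a family of sets of large average density
indexed by words over `ι`, the sets along some line have a large intersection. -/
lemma exists_line_dens_le {ι Z : Type} [Finite ι] [Finite Z] [Nonempty Z] [Nonempty α] {δ : ℝ}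
    (hδ : 0 < δ)
    (hι : ∀ A : Set (ι → α), δ / 2 ≤ dens A → ∃ l : Line α ι, ∀ a, l a ∈ A)
    (A : (ι → α) → Set Z) (hA : δ ≤ avg fun w ↦ dens (A w)) :
    ∃ l : Line α ι, δ / 2 / Nat.card (Line α ι) ≤ dens {z | ∀ a, z ∈ A (l a)} := by
  have hA' : δ ≤ avg fun z ↦ dens {w | z ∈ A w} := hA.trans_eq (avg_comm _)
  have hG := half_le_dens (fun z ↦ dens_le_one _) hδ.le hA'
  have hline : ∀ z ∈ {z | δ / 2 ≤ dens {w | z ∈ A w}}, ∃ l : Line α ι, z ∈ {z | ∀ a, z ∈ A (l a)} :=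
    fun z hz ↦ hι _ hz
  obtain ⟨z, hz⟩ := nonempty_of_dens_pos ((half_pos hδ).trans_le hG)
  have : Nonempty (Line α ι) := ⟨(hline z hz).choose⟩
  obtain ⟨l, hl⟩ := exists_dens_le_of_forall_exists _ _ hline
  exact ⟨l, le_trans (by gcongr) hl⟩

/-- The multidimensional version of the density Hales–Jewett property. -/
lemma DensityHJ.exists_subspace [Nonempty α] (h : DensityHJ α) (m : ℕ) : ∀ δ : ℝ, 0 < δ →
    ∃ n : ℕ, ∀ (ι : Type) [Finite ι], n ≤ Nat.card ι → ∀ A : Set (ι → α),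
      δ ≤ dens A → ∃ V : Subspace (Fin m) α ι, ∀ x, V x ∈ A := by
  induction m with
  | zero =>
    refine fun δ hδ ↦ ⟨0, fun ι _ _ A hA ↦ ?_⟩
    obtain ⟨w, hw⟩ := nonempty_of_dens_pos (hδ.trans_le hA)
    exact ⟨⟨fun i ↦ Sum.inl (w i), fun e ↦ e.elim0⟩, fun x ↦ hw⟩
  | succ m ih =>
    intro δ hδ
    obtain ⟨k, hk⟩ := h (δ / 2) (half_pos hδ)
    rcases isEmpty_or_nonempty (Line α (Fin k)) with hempty | hne
    · refine ⟨k, fun ι _ hι A hA ↦ ?_⟩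
      have := hk (Fin k) (by simp) Set.univ (by
        have := dens_le_one A
        have : dens (Set.univ : Set (Fin k → α)) = 1 := by simp [dens, Pi.one_def]
        linarith)
      exact (hempty.false this.choose).elim
    obtain ⟨n, hn⟩ := ih (δ / 2 / Nat.card (Line α (Fin k))) (by
      have : 0 < Nat.card (Line α (Fin k)) := Nat.card_pos
      positivity)
    refine ⟨k + n, fun ι _ hι A hA ↦ ?_⟩
    obtain ⟨ι', _, hcard, ⟨e⟩⟩ := exists_sum_equiv (Fin k) ι (by simp; omega)
    rw [dens_words' e] at hA
    obtain ⟨l, hl⟩ := exists_line_dens_le hδ (hk (Fin k) (by simp)) _ hA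
    obtain ⟨V, hV⟩ := hn ι' (by rw [Nat.card_fin] at hcard; omega) _ hl
    obtain ⟨e'⟩ : Nonempty (Fin (m + 1) ≃ Unit ⊕ Fin m) := Finite.card_eq.1 (by simp [add_comm])
    refine ⟨subspaceComp (subspaceProd l.toSubspaceUnit V e) (subspaceOfEquiv e'), fun x ↦ ?_⟩
    simpa using hV ((x ∘ e'.symm) ∘ Sum.inr) (x (e'.symm (Sum.inl ())))

end Multidimensional

/-! ### Insensitive sets -/

section Insensitive

variable {α : Type}

/-- A set of words over `Option α` is insensitive with respect to `a` if it is invariant under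
exchanging occurrences of `none` and of `some a`. -/
def Insensitive {ι : Type} (a : α) (E : Set (ι → Option α)) : Prop :=
  ∀ x y : ι → Option α, (∀ i, (x i).getD a = (y i).getD a) → x ∈ E → y ∈ E

variable [Finite α]

/-- Averaging over words over `Option α` can be done by choosing the occurrences of `none` first. -/
lemma avg_map_const {ι : Type} [Finite ι] [Nonempty α] (F : (ι → Option α) → ℝ) :
    (avg fun x : ι → Option α ↦ avg fun u : ι → α ↦ F fun i ↦ (x i).map fun _ ↦ u i) = avg F := by
  let σ : (ι → α) × (ι → Option α) → (ι → α) × (ι → Option α) := fun p ↦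
    (fun i ↦ (p.2 i).getD (p.1 i), fun i ↦ (p.2 i).map fun _ ↦ p.1 i)
  have hσ : Function.Involutive σ := fun p ↦ by
    ext i : 2
    · cases h : p.2 i <;> simp [σ, h]
    · cases h : p.2 i <;> simp [σ, h]
  have h1 := avg_equiv hσ.toPerm fun p ↦ F p.2
  rw [avg_prod, avg_prod] at h1
  simpa [σ] using h1

/-- Few words over `Option α` have a bounded number of letters different from `none`. -/
lemma exists_avg_pow_lt [Nonempty α] (M : ℕ) {η : ℝ} (hη : 0 < η) :
    ∃ n : ℕ, ∀ (ι : Type) [Finite ι], n ≤ Nat.card ι →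
      (avg fun x : ι → Option α ↦ (2 : ℝ) ^ M * (1 / 2) ^ Nat.card {i // x i ≠ none}) < η := by
  classical
  let g : Option α → ℝ := fun b ↦ if b = none then 1 else 1 / 2
  have hg0 : 0 ≤ avg g := avg_nonneg fun b ↦ by simp only [g]; split_ifs <;> norm_num
  have hg1 : avg g < 1 := by
    have := Fintype.ofFinite α
    have : 0 < Fintype.card α := Fintype.card_pos
    rw [avg_eq_sum_div, Fintype.sum_option]
    simp [g]
    rw [div_lt_one (by positivity)]
    have : (0 : ℝ) < Fintype.card α := by exact_mod_cast this
    linarith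
  obtain ⟨n, hn⟩ := exists_pow_lt_of_lt_one (show 0 < η / 2 ^ M by positivity) hg1
  refine ⟨n, fun ι _ hι ↦ ?_⟩
  have := Fintype.ofFinite ι
  have hprod (x : ι → Option α) : (1 / 2 : ℝ) ^ Nat.card {i // x i ≠ none} = ∏ i, g (x i) := by
    simp [g, prod_ite, Fintype.card_subtype]
  simp only [hprod]
  rw [avg_mul_left, avg_pi_prod]
  calc (2 : ℝ) ^ M * avg g ^ Nat.card ι ≤ 2 ^ M * avg g ^ n := by
        gcongr 2 ^ M * ?_
        exact pow_le_pow_of_le_one hg0 hg1.le hι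
    _ < 2 ^ M * (η / 2 ^ M) := by gcongr
    _ = η := by field_simp

/-- Dense insensitive sets contain subspaces. -/
lemma DensityHJ.exists_subspace_of_insensitive [Nonempty α] (h : DensityHJ α) (m : ℕ) {η : ℝ}
    (hη : 0 < η) : ∃ n : ℕ, ∀ (ι : Type) [Finite ι], n ≤ Nat.card ι →
      ∀ (a : α) (E : Set (ι → Option α)), Insensitive a E → η ≤ dens E →
        ∃ V : Subspace (Fin m) (Option α) ι, ∀ x, V x ∈ E := by
  classical
  obtain ⟨M, hM⟩ := h.exists_subspace m (η / 2) (half_pos hη)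
  obtain ⟨n, hn⟩ := exists_avg_pow_lt (α := α) M (half_pos hη)
  refine ⟨n, fun ι _ hι a E hE hd ↦ ?_⟩
  obtain ⟨x, hxM, hx⟩ : ∃ x : ι → Option α, M ≤ Nat.card {i // x i ≠ none} ∧
      η / 2 ≤ dens {u : ι → α | (fun i ↦ (x i).map fun _ ↦ u i) ∈ E} := by
    by_contra! hcon
    have h1 : dens E ≤ avg fun x : ι → Option α ↦
        η / 2 + (2 : ℝ) ^ M * (1 / 2) ^ Nat.card {i // x i ≠ none} := by
      rw [dens, ← avg_map_const]
      refine avg_mono fun x ↦ ?_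
      have hpos : (0 : ℝ) < 2 ^ M * (1 / 2) ^ Nat.card {i // x i ≠ none} := by positivity
      rcases le_or_gt M (Nat.card {i // x i ≠ none}) with hM | hM
      · exact (hcon x hM).le.trans (by linarith)
      · have h2 : (1 : ℝ) ≤ 2 ^ M * (1 / 2) ^ Nat.card {i // x i ≠ none} := by
          rw [one_div, inv_pow, ← div_eq_mul_inv, one_le_div (by positivity)]
          exact pow_le_pow_right₀ one_le_two hM.le
        have := dens_le_one {u : ι → α | (fun i ↦ (x i).map fun _ ↦ u i) ∈ E}
        refine le_trans this (by linarith)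
    rw [avg_add, avg_const] at h1
    have := hn ι hι
    linarith
  let e := Equiv.sumCompl fun i ↦ x i ≠ none
  rw [dens_words e] at hx
  obtain ⟨z, hz⟩ := exists_le_avg fun z : {i // ¬ x i ≠ none} → α ↦
    dens {y : {i // x i ≠ none} → α |
      Sum.elim y z ∘ e.symm ∈ {u : ι → α | (fun i ↦ (x i).map fun _ ↦ u i) ∈ E}}
  obtain ⟨V, hV⟩ := hM _ hxM _ (hx.trans hz)
  refine ⟨subspaceExtend (subspaceOption V) (fun _ ↦ none) e, fun y ↦ ?_⟩
  refine hE _ _ (fun i ↦ ?_) (hV fun j ↦ (y j).getD a)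
  simp only [subspaceExtend_apply, Function.comp_apply]
  by_cases hi : x i = none
  · have : e.symm i = Sum.inr ⟨i, by simpa⟩ := Equiv.sumCompl_symm_apply_of_neg (by simpa)
    simp [hi, this]
  · have : e.symm i = Sum.inl ⟨i, hi⟩ := 
      Equiv.sumCompl_symm_apply_of_pos (p := fun i ↦ x i ≠ none) hi
    obtain ⟨b, hb⟩ := Option.ne_none_iff_exists'.1 hi
    rw [this, hb]
    simp only [Sum.elim_inl, Option.map_some, Option.getD_some]
    exact (congrFun (subspaceOption_getD V y a) _).symm

/-- One step of the exhaustion of a set by subspaces: a part of the set which is covered by a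
subspace if possible. -/
lemma exists_subset_covered {κ : Type} [Finite κ] (m : ℕ) (S : Set (κ → Option α)) :
    ∃ P ⊆ S, (∀ g : (κ → Option α) → ℝ, (∀ V : Subspace (Fin m) (Option α) κ, (∀ x, V x ∈ S) →
      avg (fun x ↦ g (V x)) ≤ 0) → avg (P.indicator g) ≤ 0) ∧
      ((∃ V : Subspace (Fin m) (Option α) κ, ∀ x, V x ∈ S) →
        1 / (Nat.card (κ → Option α) : ℝ) ≤ dens P) := by
  by_cases h : ∃ V : Subspace (Fin m) (Option α) κ, ∀ x, V x ∈ S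
  · obtain ⟨V, hV⟩ := h
    refine ⟨Set.range V, Set.range_subset_iff.2 hV, fun g hg ↦ ?_, fun _ ↦ ?_⟩
    · rw [avg_indicator_range (subspace_injective V)]
      exact mul_nonpos_of_nonneg_of_nonpos (by positivity) (hg V hV)
    · rw [dens, avg_indicator_range (subspace_injective V)]
      simp only [Pi.one_apply, avg_const, mul_one]
      gcongr
      exact_mod_cast Nat.card_pos
  · refine ⟨∅, Set.empty_subset _, fun g _ ↦ ?_, fun h' ↦ (h h').elim⟩
    simp

/-- If the average of a function over all `m`-dimensional subspaces contained in an insensitive set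
is nonpositive, then its average over this set is almost nonpositive. -/
lemma DensityHJ.avg_le_of_insensitive [Nonempty α] (h : DensityHJ α) (m : ℕ) {η : ℝ}
    (hη : 0 < η) : ∃ n : ℕ, ∀ (ι : Type) [Finite ι], n ≤ Nat.card ι →
      ∀ (a : α) (E : Set (ι → Option α)), Insensitive a E → ∀ f : (ι → Option α) → ℝ,
        (∀ x, f x ≤ 1) → (∀ V : Subspace (Fin m) (Option α) ι, (∀ x, V x ∈ E) →
          avg (fun x ↦ f (V x)) ≤ 0) → avg (E.indicator f) ≤ η := by
  obtain ⟨k, hk⟩ := h.exists_subspace_of_insensitive m (half_pos hη)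
  set c : ℝ := 1 / (Nat.card (Fin k → Option α) : ℝ) with hc
  have hcard : (1 : ℝ) ≤ Nat.card (Fin k → Option α) := by exact_mod_cast Nat.card_pos
  have hc0 : 0 < c := by positivity
  have hc1 : c ≤ 1 := (div_le_one (by positivity)).2 hcard
  have key (R : ℕ) : ∀ (ι : Type) [Finite ι], R * k ≤ Nat.card ι →
      ∀ (a : α) (E : Set (ι → Option α)), Insensitive a E → ∀ f : (ι → Option α) → ℝ,
        (∀ x, f x ≤ 1) → (∀ V : Subspace (Fin m) (Option α) ι, (∀ x, V x ∈ E) →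
          avg (fun x ↦ f (V x)) ≤ 0) →
            avg (E.indicator f) ≤ η / 2 + (1 - c) ^ R * (dens E - η / 2) := by
    induction R with
    | zero =>
      intro ι _ _ a E _ f hf _
      have : avg (E.indicator f) ≤ dens E := avg_mono fun x ↦ Set.indicator_le_indicator (hf x)
      linarith
    | succ R ih =>
      intro ι _ hι a E hE f hf hV
      obtain ⟨ι', _, hι', ⟨e⟩⟩ := exists_sum_equiv (Fin k) ι (by rw [Nat.card_fin]; nlinarith)
      rw [Nat.card_fin] at hι'
      choose P hPS hPg hPd using exists_subset_covered (α := α) (κ := Fin k) m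
      let S (z : ι' → Option α) : Set (Fin k → Option α) := {y | Sum.elim y z ∘ e.symm ∈ E}
      let E' (y : Fin k → Option α) : Set (ι' → Option α) := {z | y ∈ S z \ P (S z)}
      have hSins (z) : Insensitive a (S z) := fun y y' hy hyS ↦ hE _ _ (fun i ↦ by
        cases hi : e.symm i <;> simp [hi, hy]) hyS
      have hSeq (z z' : ι' → Option α) (hz : ∀ i, (z i).getD a = (z' i).getD a) : S z = S z' := by
        ext y
        exact ⟨hE _ _ fun i ↦ by cases hi : e.symm i <;> simp [hi, hz],
          hE _ _ fun i ↦ by cases hi : e.symm i <;> simp [hi, hz]⟩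
      have hE' (y) : Insensitive a (E' y) := fun z z' hz hzE ↦ by
        simpa only [E', Set.mem_ofPred_eq, hSeq z z' hz] using hzE
      have hPdens (z) : c * (dens (S z) - η / 2) ≤ dens (P (S z)) := by
        rcases le_or_gt (η / 2) (dens (S z)) with hz | hz
        · have h1 := hPd (S z) (hk (Fin k) (by simp) a _ (hSins z) hz)
          have h2 := dens_le_one (S z)
          nlinarith
        · exact (mul_nonpos_of_nonneg_of_nonpos hc0.le (by linarith)).trans (dens_nonneg _)
      have hcov : (avg fun z ↦ avg ((P (S z)).indicator fun y ↦ f (Sum.elim y z ∘ e.symm))) ≤ 0 := by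
        refine (avg_mono (g := fun _ ↦ 0) fun z ↦ ?_).trans_eq (avg_const 0)
        refine hPg _ _ fun V hVS ↦ ?_
        simpa using hV (subspaceExtend V z e) fun x ↦ by
          rw [subspaceExtend_apply]
          exact hVS x
      have hrest (y) : avg ((E' y).indicator fun z ↦ f (Sum.elim y z ∘ e.symm)) ≤
          η / 2 + (1 - c) ^ R * (dens (E' y) - η / 2) := by
        refine ih ι' (by nlinarith) a _ (hE' y) _ (fun z ↦ hf _) fun V hVE ↦ ?_
        have hap (x) : subspaceExtend V y ((Equiv.sumComm _ _).trans e) x =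
            Sum.elim y (V x) ∘ e.symm := by
          ext i
          cases hi : e.symm i <;> simp [hi]
        simpa only [hap] using hV (subspaceExtend V y ((Equiv.sumComm _ _).trans e)) fun x ↦ by
          rw [hap]
          exact (hVE x).1
      have hsplit : avg (E.indicator f) =
          (avg fun z ↦ avg ((P (S z)).indicator fun y ↦ f (Sum.elim y z ∘ e.symm))) +
          avg fun y ↦ avg ((E' y).indicator fun z ↦ f (Sum.elim y z ∘ e.symm)) := by
        rw [avg_words e, avg_comm fun y z ↦ (E' y).indicator (fun z ↦ f (Sum.elim y z ∘ e.symm)) z,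
          ← avg_add]
        congr! 2 with z
        rw [← avg_add]
        congr! 2 with y
        by_cases hy : y ∈ S z
        · rw [Set.indicator_of_mem (by exact hy)]
          by_cases hy' : y ∈ P (S z) <;> simp [E', hy, hy']
        · have hy' : y ∉ P (S z) := fun h ↦ hy (hPS _ h)
          rw [Set.indicator_of_notMem (by exact hy)]
          simp [E', hy, hy']
      have hdens : (avg fun y ↦ dens (E' y)) = dens E - avg fun z ↦ dens (P (S z)) := by
        rw [dens_words e, ← avg_sub]
        refine (avg_comm _).trans ?_
        congr! 2 with z
        simp only [dens]
        rw [← avg_sub]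
        congr! 2 with y
        change _ = (S z).indicator 1 y - (P (S z)).indicator 1 y
        by_cases hy : y ∈ S z
        · by_cases hy' : y ∈ P (S z) <;> simp [E', hy, hy']
        · have hy' : y ∉ P (S z) := fun h ↦ hy (hPS _ h)
          simp [E', hy, hy']
      have hgain : c * (dens E - η / 2) ≤ avg fun z ↦ dens (P (S z)) := by
        have := avg_mono hPdens
        rw [avg_mul_left, avg_sub, avg_const] at this
        rwa [dens_words e]
      have hsum := avg_mono hrest
      rw [avg_add, avg_mul_left, avg_sub, avg_const, hdens] at hsum
      have hpow : 0 ≤ (1 - c) ^ R := pow_nonneg (by linarith) R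
      rw [hsplit, pow_succ, mul_assoc]
      nlinarith [mul_le_mul_of_nonneg_left hgain hpow]
  obtain ⟨R, hR⟩ := exists_pow_lt_of_lt_one (half_pos hη) (show 1 - c < 1 by linarith)
  refine ⟨R * k, fun ι _ hι a E hE f hf hV ↦ (key R ι hι a E hE f hf hV).trans ?_⟩
  have hpow : 0 ≤ (1 - c) ^ R := pow_nonneg (by linarith) R
  nlinarith [dens_le_one E]

/-- If the average of a function over all `m`-dimensional subspaces contained in an intersection of
insensitive sets is nonpositive, then its average over this intersection is almost nonpositive. -/
lemma DensityHJ.avg_le_of_forall_insensitive [Nonempty α] (h : DensityHJ α) (T : Finset α) :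
    ∀ (m : ℕ) (η : ℝ), 0 < η → ∃ n : ℕ, ∀ (ι : Type) [Finite ι], n ≤ Nat.card ι →
      ∀ E : α → Set (ι → Option α), (∀ a, Insensitive a (E a)) → ∀ f : (ι → Option α) → ℝ,
        (∀ x, f x ≤ 1) → (∀ V : Subspace (Fin m) (Option α) ι, (∀ x, ∀ a ∈ T, V x ∈ E a) →
          avg (fun x ↦ f (V x)) ≤ 0) → avg ({x | ∀ a ∈ T, x ∈ E a}.indicator f) ≤ η := by
  classical
  induction T using Finset.induction_on with
  | empty =>
    intro m η hη
    obtain ⟨n, hn⟩ := h.avg_le_of_insensitive m hη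
    refine ⟨n, fun ι _ hι E _ f hf hV ↦ ?_⟩
    have := hn ι hι (Classical.arbitrary α) Set.univ (fun _ _ _ _ ↦ trivial) f hf fun V _ ↦
      hV V (by simp)
    simpa using this
  | insert a T _ ih =>
    intro m η hη
    obtain ⟨k, hk⟩ := h.avg_le_of_insensitive m (half_pos hη)
    obtain ⟨n, hn⟩ := ih k (η / 2) (half_pos hη)
    refine ⟨n, fun ι _ hι E hE f hf hV ↦ ?_⟩
    have hind (x) : (E a).indicator f x ≤ 1 :=
      Set.indicator_le' (g := fun _ ↦ (1 : ℝ)) (fun x _ ↦ hf x) (fun _ _ ↦ zero_le_one) x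
    have hT := hn ι hι E hE (fun x ↦ (E a).indicator f x - η / 2) (fun x ↦ by linarith [hind x])
      fun W hW ↦ by
        have := hk (Fin k) (by simp) a {x | W x ∈ E a}
          (fun x y hxy ↦ hE a _ _ (getD_apply_eq W hxy)) (fun x ↦ f (W x)) (fun x ↦ hf _)
          fun V hVE ↦ by
            simpa using hV (subspaceComp W V) fun x b hb ↦ by
              rw [subspaceComp_apply]
              rcases mem_insert.1 hb with rfl | hb
              exacts [hVE x, hW _ b hb]
        rw [avg_sub, avg_const, sub_nonpos]
        exact this
    have hle : avg ({x | ∀ b ∈ insert a T, x ∈ E b}.indicator f) ≤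
        avg fun x ↦ {x | ∀ b ∈ T, x ∈ E b}.indicator (fun x ↦ (E a).indicator f x - η / 2) x +
          η / 2 := by
      refine avg_mono fun x ↦ ?_
      by_cases hxT : ∀ b ∈ T, x ∈ E b
      · rw [Set.indicator_of_mem (s := {x | ∀ b ∈ T, x ∈ E b}) hxT]
        by_cases hxa : x ∈ E a
        · rw [Set.indicator_of_mem, Set.indicator_of_mem hxa]
          · linarith
          · simpa [hxa] using hxT
        · rw [Set.indicator_of_notMem, Set.indicator_of_notMem hxa]
          · linarith
          · exact fun h ↦ hxa (h a (mem_insert_self a T))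
      · rw [Set.indicator_of_notMem (s := {x | ∀ b ∈ T, x ∈ E b}) hxT, Set.indicator_of_notMem]
        · linarith
        · exact fun h ↦ hxT fun b hb ↦ h b (mem_insert_of_mem hb)
    rw [avg_add, avg_const] at hle
    linarith

end Insensitive

/-! ### The density increment -/

section Increment

lemma dens_singleton {X : Type} [Finite X] (x : X) : dens {x} = 1 / (Nat.card X : ℝ) := by
  classical
  have := Fintype.ofFinite X
  simp [dens, avg_eq_sum_div]

/-- Every set of long words has, after passing to a subspace, almost no sections over `κ` of density
smaller than that of the set. -/
lemma exists_uniform_sections {α : Type} [Finite α] [Nonempty α] (κ : Type) [Finite κ] {ε : ℝ}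
    (hε : 0 < ε) : ∃ n : ℕ, ∀ (ι : Type) [Finite ι], n ≤ Nat.card ι → ∀ (δ : ℝ)
      (A : Set (ι → α)), δ ≤ dens A → ∃ (ι' : Type) (_ : Finite ι') (V : Subspace (κ ⊕ ι') α ι),
        ∀ y : κ → α, δ - ε ≤ dens {z : ι' → α | V (Sum.elim y z) ∈ A} := by
  have hN : (0 : ℝ) < Nat.card (κ → α) := by exact_mod_cast Nat.card_pos
  set c : ℝ := ε / Nat.card (κ → α) with hc
  have hc0 : 0 < c := by positivity
  have key (R : ℕ) : ∀ (ι : Type) [Finite ι], R * Nat.card κ ≤ Nat.card ι → ∀ (δ : ℝ)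
      (A : Set (ι → α)), δ ≤ dens A → 1 + c ≤ dens A + R * c →
      ∃ (ι' : Type) (_ : Finite ι') (V : Subspace (κ ⊕ ι') α ι),
        ∀ y : κ → α, δ - ε ≤ dens {z : ι' → α | V (Sum.elim y z) ∈ A} := by
    induction R with
    | zero =>
      intro ι _ _ δ A _ hA
      have := dens_le_one A
      simp only [Nat.cast_zero, zero_mul] at hA
      linarith
    | succ R ih =>
      intro ι _ hι δ A hδ hA
      obtain ⟨ι', _, hι', ⟨e⟩⟩ := exists_sum_equiv κ ι (by nlinarith)
      by_cases hall : ∀ y : κ → α, δ - ε ≤ dens {z : ι' → α | Sum.elim y z ∘ e.symm ∈ A}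
      · exact ⟨ι', inferInstance, subspaceOfEquiv e, hall⟩
      obtain ⟨y₀, hy₀⟩ := not_forall.1 hall
      obtain ⟨y, hy⟩ : ∃ y : κ → α, dens A + c ≤ dens {z : ι' → α | Sum.elim y z ∘ e.symm ∈ A} := by
        by_contra! hlt
        have hle := avg_mono (f := fun y : κ → α ↦ dens {z : ι' → α | Sum.elim y z ∘ e.symm ∈ A})
          (g := fun y ↦ (dens A + c) - (ε + c) * ({y₀} : Set (κ → α)).indicator 1 y) fun y ↦ by
            by_cases hyy : y = y₀
            · subst hyy
              simp only [Set.mem_singleton_iff, Set.indicator_of_mem, Pi.one_apply]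
              linarith
            · simpa [hyy] using (hlt y).le
        rw [← dens_words' e, avg_sub, avg_const, avg_mul_left] at hle
        change _ ≤ _ - _ * dens {y₀} at hle
        have : c < (ε + c) * dens {y₀} := by
          rw [dens_singleton, add_mul, mul_one_div, ← hc]
          have : 0 < c * (1 / (Nat.card (κ → α) : ℝ)) := by positivity
          linarith
        linarith
      obtain ⟨ι'', _, V, hV⟩ := ih ι' (by nlinarith) δ _ (by linarith) (by
        push_cast at hA
        have : dens A + c + R * c ≤ _ := add_le_add_left hy (R * c)
        linarith)
      refine ⟨ι'', inferInstance, subspaceExtend V y ((Equiv.sumComm _ _).trans e), fun y' ↦ ?_⟩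
      convert hV y' using 4 with z
      rw [subspaceExtend_apply, Set.mem_ofPred_eq]
      congr! 1
      ext i
      cases hi : e.symm i <;> simp [hi]
  obtain ⟨R, hR⟩ := exists_nat_ge ((1 + c) / c)
  refine ⟨R * Nat.card κ, fun ι _ hι δ A hA ↦ key R ι hι δ A hA ?_⟩
  rw [div_le_iff₀ hc0] at hR
  linarith [dens_nonneg A]

variable {α : Type} [Finite α]

/-- Few long words avoid a given letter. -/
lemma exists_dens_forall_ne_none_le [Nonempty α] {τ : ℝ} (hτ : 0 < τ) : ∃ n : ℕ, ∀ m ≥ n,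
    dens {y : Fin m → Option α | ∀ i, y i ≠ none} ≤ τ := by
  classical
  set g : Option α → ℝ := fun b ↦ 1 - ({none} : Set (Option α)).indicator 1 b with hg
  have hg0 (b) : 0 ≤ g b := by
    by_cases hb : b = none <;> simp [g, hb]
  have hg1 : avg g < 1 := by
    rw [hg, avg_sub, avg_const]
    change 1 - dens {none} < 1
    rw [dens_singleton]
    have : (0 : ℝ) < Nat.card (Option α) := by exact_mod_cast Nat.card_pos
    have : 0 < 1 / (Nat.card (Option α) : ℝ) := by positivity
    linarith
  obtain ⟨n, hn⟩ := exists_pow_lt_of_lt_one hτ hg1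
  refine ⟨n, fun m hm ↦ ?_⟩
  have := avg_pi_prod (ι := Fin m) g
  rw [Nat.card_fin] at this
  calc dens {y : Fin m → Option α | ∀ i, y i ≠ none}
      ≤ avg fun y : Fin m → Option α ↦ ∏ i, g (y i) := avg_mono fun y ↦ by
        by_cases hy : ∀ i, y i ≠ none
        · rw [Set.indicator_of_mem (by exact hy)]
          simp [g, hy]
        · rw [Set.indicator_of_notMem (by exact hy)]
          exact prod_nonneg fun i _ ↦ hg0 _
    _ = avg g ^ m := this
    _ ≤ avg g ^ n := pow_le_pow_of_le_one (avg_nonneg hg0) hg1.le hm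
    _ ≤ τ := hn.le

/-- The letterwise substitution of `a` for `none`. -/
def fill {ι : Type} (a : α) (y : ι → Option α) : ι → Option α := fun i ↦ some ((y i).getD a)

/-- A family of sets with uniform density, without lines, and with many lines except for one point,
correlates positively with some intersection of insensitive sets and their complements. -/
lemma exists_pattern {K Z : Type} [Finite K] [Finite Z] [Nonempty Z] {δ₀ δ θ : ℝ}
    (hδ₀ : 0 < δ₀) (hδ₁ : δ₀ ≤ 1) (hδ : δ₀ ≤ δ) (hθ : 0 < θ) (hθ₁ : θ ≤ 1)
    (B : (K → Option α) → Set Z) (hsec : ∀ y, δ - δ₀ * θ / 8 ≤ dens (B y))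
    (hgood : ∀ y : K → Option α, (∃ i, y i = none) → θ ≤ dens {z | ∀ a, z ∈ B (fill a y)})
    (hline : ∀ y : K → Option α, (∃ i, y i = none) → ∀ z ∈ B y, ¬ ∀ a, z ∈ B (fill a y))
    (hfew : dens {y : K → Option α | ∀ i, y i ≠ none} ≤ δ₀ * θ / 8) :
    ∃ (S : Set α) (z : Z), δ₀ * θ / 2 / Nat.card (Set α) ≤
      avg ({y : K → Option α | {a | z ∈ B (fill a y)} = S}.indicator
        fun y ↦ (B y).indicator 1 z - (δ + δ₀ * θ / 8)) := by
  classical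
  have := Fintype.ofFinite (Set α)
  have hpos : 0 < δ₀ * θ := by positivity
  set γ := δ₀ * θ / 8 with hγ
  let F (S : Set α) (z : Z) (y : K → Option α) : ℝ :=
    {y : K → Option α | {a | z ∈ B (fill a y)} = S}.indicator
      (fun y ↦ (B y).indicator 1 z - (δ + γ)) y
  let G (S : Set α) : ℝ := avg fun z ↦ avg fun y ↦ F S z y
  have hsum : -(2 * γ) ≤ ∑ S, G S := by
    have h1 : ∑ S, G S = avg fun y ↦ dens (B y) - (δ + γ) := by
      simp only [G]
      rw [← avg_sum]
      simp only [← avg_sum]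
      rw [avg_comm]
      congr! 2 with y
      have : dens (B y) - (δ + γ) = avg fun z ↦ (B y).indicator 1 z - (δ + γ) := by
        rw [avg_sub, avg_const, dens]
      rw [this]
      congr! 2 with z
      simp only [F, Set.indicator_apply, Set.mem_ofPred_eq]
      rw [Finset.sum_ite_eq]
      simp
    rw [h1, ← avg_const (X := K → Option α) (-(2 * γ))]
    exact avg_mono fun y ↦ by linarith [hsec y]
  have huniv : G Set.univ ≤ -(δ₀ * θ) + 2 * γ := by
    have h1 (y : K → Option α) : (avg fun z ↦ F Set.univ z y) ≤
        -(δ₀ * θ) + 2 * {y : K → Option α | ∀ i, y i ≠ none}.indicator 1 y := by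
      by_cases hy : ∀ i, y i ≠ none
      · rw [Set.indicator_of_mem (by exact hy)]
        have : (avg fun z ↦ F Set.univ z y) ≤ avg fun _ : Z ↦ (1 : ℝ) := avg_mono fun z ↦ by
          simp only [F]
          refine Set.indicator_apply_le' (fun _ ↦ ?_) fun _ ↦ zero_le_one
          have : (B y).indicator (1 : Z → ℝ) z ≤ 1 :=
            Set.indicator_le_self' (fun _ _ ↦ zero_le_one) z
          linarith
        rw [avg_const] at this
        simp only [Pi.one_apply]
        nlinarith
      · have hy' : ∃ i, y i = none := by simpa using hy
        rw [Set.indicator_of_notMem (by exact hy)]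
        have : (fun z ↦ F Set.univ z y) = fun z ↦
            -(δ + γ) * {z | ∀ a, z ∈ B (fill a y)}.indicator 1 z := by
          funext z
          by_cases hz : ∀ a, z ∈ B (fill a y)
          · have hzB : z ∉ B y := fun h ↦ hline y hy' z h hz
            simp only [F]
            rw [Set.indicator_of_mem (by exact Set.eq_univ_of_forall hz),
              Set.indicator_of_notMem hzB, Set.indicator_of_mem (by exact hz)]
            simp
          · simp only [F]
            rw [Set.indicator_of_notMem (by exact fun h ↦ hz (Set.eq_univ_iff_forall.1 h)),
              Set.indicator_of_notMem (by exact hz), mul_zero]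
        rw [this, avg_mul_left]
        change _ * dens _ ≤ _
        nlinarith [hgood y hy']
    calc G Set.univ = avg fun y ↦ avg fun z ↦ F Set.univ z y := avg_comm _
      _ ≤ _ := avg_mono h1
      _ = -(δ₀ * θ) + 2 * dens {y : K → Option α | ∀ i, y i ≠ none} := by
        rw [avg_add, avg_const, avg_mul_left]
        rfl
      _ ≤ _ := by linarith
  have hcard : (0 : ℝ) < Nat.card (Set α) := by exact_mod_cast Nat.card_pos
  obtain ⟨S, hS⟩ : ∃ S, δ₀ * θ / 2 / Nat.card (Set α) ≤ G S := by
    by_contra! hlt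
    have h1 : ∑ S ∈ univ.erase Set.univ, G S ≤
        #(univ.erase (Set.univ : Set α)) • (δ₀ * θ / 2 / Nat.card (Set α)) :=
      sum_le_card_nsmul _ _ _ fun S _ ↦ (hlt S).le
    have h2 : (#(univ.erase (Set.univ : Set α)) : ℝ) < Nat.card (Set α) := by
      rw [Nat.card_eq_fintype_card]
      exact_mod_cast card_erase_lt_of_mem (mem_univ _)
    have h3 : (#(univ.erase (Set.univ : Set α)) : ℝ) * (δ₀ * θ / 2 / Nat.card (Set α)) <
        δ₀ * θ / 2 := by
      calc _ < (Nat.card (Set α) : ℝ) * (δ₀ * θ / 2 / Nat.card (Set α)) := by gcongr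
        _ = _ := mul_div_cancel₀ _ hcard.ne'
    rw [nsmul_eq_mul] at h1
    rw [← add_sum_erase _ _ (mem_univ Set.univ)] at hsum
    linarith
  obtain ⟨z, hz⟩ := exists_le_avg fun z ↦ avg fun y ↦ F S z y
  exact ⟨S, z, hS.trans hz⟩

/-- Either a dense set of words over `Option α` contains a line, or its density increases on some
subspace of large dimension. -/
lemma DensityHJ.exists_increment [Nonempty α] (h : DensityHJ α) {δ₀ : ℝ} (hδ₀ : 0 < δ₀)
    (hδ₁ : δ₀ ≤ 1) : ∃ γ > 0, ∀ m : ℕ, ∃ n : ℕ, ∀ (ι : Type) [Finite ι], n ≤ Nat.card ι →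
      ∀ δ ≥ δ₀, ∀ A : Set (ι → Option α), δ ≤ dens A → (∃ l : Line (Option α) ι, ∀ a, l a ∈ A) ∨
        ∃ V : Subspace (Fin m) (Option α) ι, δ + γ ≤ dens {x | V x ∈ A} := by
  classical
  have := Fintype.ofFinite α
  obtain ⟨M, hM⟩ := h (δ₀ / 2 / 2) (by positivity)
  set θ : ℝ := δ₀ / 2 / 2 / Nat.card (Line α (Fin (M + 1))) with hθ
  have hLcard : (1 : ℝ) ≤ Nat.card (Line α (Fin (M + 1))) := by
    have : Nonempty (Line α (Fin (M + 1))) := ⟨default⟩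
    exact_mod_cast Nat.card_pos
  have hθ0 : 0 < θ := by positivity
  have hθ1 : θ ≤ 1 := (div_le_one (by linarith)).2 (by linarith)
  have hpos : 0 < δ₀ * θ := by positivity
  have hcard : (0 : ℝ) < Nat.card (Set α) := by exact_mod_cast Nat.card_pos
  refine ⟨δ₀ * θ / 8, by positivity, fun m ↦ ?_⟩
  obtain ⟨n₁, hn₁⟩ := h.avg_le_of_forall_insensitive univ m
    (δ₀ * θ / 2 / Nat.card (Set α) / 2) (by positivity)
  obtain ⟨n₂, hn₂⟩ := exists_dens_forall_ne_none_le (α := α) (show 0 < δ₀ * θ / 8 by positivity)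
  set N := max (M + 1) (max n₁ n₂)
  obtain ⟨κ, _, hκ⟩ := exists_subspace_lines_mono α Prop N
  obtain ⟨n, hn⟩ := exists_uniform_sections (α := Option α) κ (show 0 < δ₀ * θ / 8 by positivity)
  refine ⟨n, fun ι _ hι δ hδ A hA ↦ ?_⟩
  obtain ⟨ι', _, V, hV⟩ := hn ι hι δ A hA
  obtain ⟨W, col, hW⟩ := hκ fun w ↦
    θ ≤ dens {z : ι' → Option α | ∀ a, V (Sum.elim (fill a w) z) ∈ A}
  have hfill (a : α) (y : Fin N → Option α) :
      fill a (subspaceOption W y) = subspaceOption W (fill a y) := by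
    refine Eq.trans ?_ (subspaceOption_some W _).symm
    rw [← subspaceOption_getD]
    rfl
  let B (y : Fin N → Option α) : Set (ι' → Option α) := {z | V (Sum.elim (subspaceOption W y) z) ∈ A}
  let Q (z : ι' → Option α) : Subspace (Fin N) (Option α) ι :=
    subspaceComp V (subspaceExtend (subspaceOption W) z (Equiv.refl _))
  have hQ (z y) : Q z y = V (Sum.elim (subspaceOption W y) z) := by simp [Q]
  have hcol : col := by
    obtain ⟨ι₁, _, -, ⟨e⟩⟩ := exists_sum_equiv (Fin (M + 1)) (Fin N) (by simp [N])
    let U : Subspace (Fin (M + 1)) α (Fin N) :=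
      subspaceExtend (subspaceOfEquiv (Equiv.refl _)) (fun _ ↦ Classical.arbitrary α) e
    obtain ⟨l, hl⟩ := exists_line_dens_le (half_pos hδ₀) (hM (Fin (M + 1)) (by simp))
      (fun y ↦ B fun i ↦ some (U y i)) (by
        rw [← avg_const (X := Fin (M + 1) → α) (δ₀ / 2)]
        refine avg_mono fun y ↦ le_trans ?_ (hV _)
        nlinarith)
    have hnone : ∃ i, subspaceOption U l.idxFun i = none := by
      obtain ⟨j, hj⟩ := l.proper
      obtain ⟨i, hi⟩ := (subspaceOption U).proper j
      exact ⟨i, by rw [Subspace.apply_inr hi, hj]⟩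
    rw [← hW _ hnone]
    convert hl using 4 with z
    refine forall_congr' fun a ↦ ?_
    rw [hfill]
    have : fill a (subspaceOption U l.idxFun) = fun i ↦ some (U (l a) i) :=
      funext fun i ↦ congrArg some (congrFun (subspaceOption_getD U l.idxFun a) i)
    rw [this]
    rfl
  by_cases hline : ∀ y : Fin N → Option α, (∃ i, y i = none) → ∀ z ∈ B y, ¬ ∀ a, z ∈ B (fill a y)
  swap
  · push Not at hline
    obtain ⟨y, hy, z, hz, hza⟩ := hline
    let l : Line (Option α) (Fin N) := ⟨fun i ↦ (y i).map some, by simpa using hy⟩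
    refine Or.inl ⟨subspaceLine (Q z) l, fun a ↦ ?_⟩
    rw [subspaceLine_apply, hQ]
    cases a with
    | none =>
      have : l none = y := by
        ext1 i
        cases hi : y i <;> simp [l, hi]
      rw [this]
      exact hz
    | some a =>
      have : l (some a) = fill a y := by
        ext1 i
        cases hi : y i <;> simp [l, hi, fill]
      rw [this]
      exact hza a
  right
  obtain ⟨S, z, hSz⟩ := exists_pattern hδ₀ hδ₁ hδ hθ0 hθ1 B (fun y ↦ hV _)
    (fun y hy ↦ by
      have := (hW y hy).symm ▸ hcol
      simp only [hfill] at this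
      exact this)
    hline (hn₂ N (by simp [N]))
  by_contra! hlt
  have := hn₁ (Fin N) (by simp [N]) (fun a ↦ {y | z ∈ B (fill a y) ↔ a ∈ S})
    (fun a x y hxy hx ↦ by
      have : fill a x = fill a y := funext fun i ↦ congrArg some (hxy i)
      simpa only [Set.mem_ofPred_eq, this] using hx)
    (fun y ↦ (B y).indicator 1 z - (δ + δ₀ * θ / 8))
    (fun y ↦ by
      have : (B y).indicator (1 : (ι' → Option α) → ℝ) z ≤ 1 :=
        Set.indicator_le_self' (fun _ _ ↦ zero_le_one) z
      linarith)
    fun V' _ ↦ by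
      have := hlt (subspaceComp (Q z) V')
      rw [avg_sub, avg_const]
      refine sub_nonpos.2 (le_trans (le_of_eq ?_) this.le)
      simp only [subspaceComp_apply, hQ]
      rfl
  have heq : {y : Fin N → Option α | {a | z ∈ B (fill a y)} = S} =
      {y | ∀ a ∈ univ, y ∈ {y | z ∈ B (fill a y) ↔ a ∈ S}} := by
    ext y
    simp [Set.ext_iff]
  rw [heq] at hSz
  have : 0 < δ₀ * θ / 2 / Nat.card (Set α) := by positivity
  linarith

end Increment

/-! ### The density Hales–Jewett theorem -/

lemma DensityHJ.option {α : Type} [Finite α] (h : DensityHJ α) : DensityHJ (Option α) := by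
  intro δ hδ
  rcases isEmpty_or_nonempty α with hα | hα
  · refine ⟨1, fun ι _ hι A hA ↦ ?_⟩
    have : Nonempty ι := (Nat.card_pos_iff.1 hι).1
    obtain ⟨w, hw⟩ := nonempty_of_dens_pos (hδ.trans_le hA)
    refine ⟨default, fun a ↦ ?_⟩
    rwa [show (default : Line (Option α) ι) a = w from Subsingleton.elim _ _]
  rcases lt_or_ge 1 δ with hδ₁ | hδ₁
  · exact ⟨0, fun ι _ _ A hA ↦ absurd (dens_le_one A) (by linarith)⟩
  obtain ⟨γ, hγ, hinc⟩ := h.exists_increment hδ hδ₁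
  have key (j : ℕ) : ∃ n : ℕ, ∀ (ι : Type) [Finite ι], n ≤ Nat.card ι →
      ∀ A : Set (ι → Option α), δ ≤ dens A → 1 + γ ≤ dens A + j * γ →
        ∃ l : Line (Option α) ι, ∀ a, l a ∈ A := by
    induction j with
    | zero =>
      refine ⟨0, fun ι _ _ A _ hA ↦ absurd (dens_le_one A) ?_⟩
      simp only [Nat.cast_zero, zero_mul] at hA
      linarith
    | succ j ih =>
      obtain ⟨m, hm⟩ := ih
      obtain ⟨n, hn⟩ := hinc m
      refine ⟨n, fun ι _ hι A hA hAj ↦ ?_⟩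
      rcases hn ι hι (dens A) hA A le_rfl with hl | ⟨V, hV⟩
      · exact hl
      push_cast at hAj
      obtain ⟨l, hl⟩ := hm (Fin m) (by simp) {x | V x ∈ A} (by linarith) (by linarith)
      exact ⟨subspaceLine V l, fun a ↦ by simpa using hl a⟩
  obtain ⟨j, hj⟩ := exists_nat_ge ((1 + γ) / γ)
  rw [div_le_iff₀ hγ] at hj
  obtain ⟨n, hn⟩ := key j
  exact ⟨n, fun ι _ hι A hA ↦ hn ι hι A hA (by linarith)⟩

lemma DensityHJ.of_equiv {α β : Type} [Finite α] [Finite β] (e : α ≃ β) (h : DensityHJ α) :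
    DensityHJ β := by
  intro δ hδ
  obtain ⟨n, hn⟩ := h δ hδ
  refine ⟨n, fun ι _ hι A hA ↦ ?_⟩
  obtain ⟨l, hl⟩ := hn ι hι {w | e ∘ w ∈ A}
    (hA.trans_eq (avg_equiv ((Equiv.refl ι).arrowCongr e) (A.indicator 1)).symm)
  refine ⟨l.map e, fun b ↦ ?_⟩
  rw [← e.apply_symm_apply b, Line.map_apply]
  exact hl _

/-- The **density Hales–Jewett theorem**. -/
theorem densityHJ (α : Type) [Finite α] : DensityHJ α := by
  suffices ∀ [Finite α], DensityHJ α from this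
  refine Finite.induction_empty_option (P := fun α ↦ ∀ [Finite α], DensityHJ α) ?_ ?_ ?_ α
  · intro α β e h _
    have := Finite.of_equiv β e.symm
    exact h.of_equiv e
  · refine fun δ hδ ↦ ⟨1, fun ι _ hι A hA ↦ ?_⟩
    obtain ⟨i⟩ := (Nat.card_pos_iff.1 hι).1
    obtain ⟨w, -⟩ := nonempty_of_dens_pos (hδ.trans_le hA)
    exact (w i).elim
  · intro α _ h _
    exact h.option

/-! ### Recurrence along combinatorial lines -/

/-- The sums of the letters along a combinatorial line form an arithmetic progression. -/
lemma sum_line {k : ℕ} {ι : Type} [Fintype ι] (l : Line (Fin k) ι) : ∃ b n : ℕ, 1 ≤ n ∧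
    ∀ a : Fin k, ∑ i, (l a i : ℕ) = a * n + b := by
  classical
  refine ⟨∑ i, (l.idxFun i).elim 0 Fin.val, #{i | l.idxFun i = none}, ?_, fun a ↦ ?_⟩
  · obtain ⟨i, hi⟩ := l.proper
    exact card_pos.2 ⟨i, by simpa using hi⟩
  · rw [card_filter, mul_sum, ← sum_add_distrib]
    refine sum_congr rfl fun i _ ↦ ?_
    cases hi : l.idxFun i <;> simp [hi]

/-- Under a measure-preserving map, some point outside a given null set visits a given set along a
set of words of large density. -/
lemma exists_le_dens_visits {X : Type*} [MeasurableSpace X] {μ : Measure X}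
    [IsProbabilityMeasure μ] {T : X → X} (hT : MeasurePreserving T μ μ) {A : Set X}
    (hA : MeasurableSet A) {W : Type} [Finite W] [Nonempty W] (s : W → ℕ) {N : Set X}
    (hN : μ N = 0) : ∃ x ∉ N, μ.real A ≤ dens {w | T^[s w] x ∈ A} := by
  classical
  have := Fintype.ofFinite W
  have hdens (x) : dens {w | T^[s w] x ∈ A} =
      (∑ w, (T^[s w] ⁻¹' A).indicator (1 : X → ℝ) x) / Nat.card W := by
    rw [dens, avg_eq_sum_div]
    rfl
  have hmeas (w) : MeasurableSet (T^[s w] ⁻¹' A) := (hT.measurable.iterate _) hA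
  have hintegrable (w) : Integrable ((T^[s w] ⁻¹' A).indicator (1 : X → ℝ)) μ :=
    (integrable_const 1).indicator (hmeas w)
  have hcard : (Nat.card W : ℝ) ≠ 0 := by exact_mod_cast Nat.card_pos.ne'
  have hintegral : ∫ x, dens {w | T^[s w] x ∈ A} ∂μ = μ.real A := by
    simp only [hdens]
    rw [integral_div, integral_finsetSum _ fun w _ ↦ hintegrable w]
    simp only [integral_indicator_one (hmeas _), (hT.iterate _).measureReal_preimage
      hA.nullMeasurableSet, sum_const, card_univ, nsmul_eq_mul, ← Nat.card_eq_fintype_card]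
    rw [mul_div_cancel_left₀ _ hcard]
  rw [← hintegral]
  refine exists_notMem_null_integral_le ?_ hN
  simp only [hdens]
  exact (integrable_finsetSum _ fun w _ ↦ hintegrable w).div_const _

end DensityHalesJewett

/-- **Furstenberg's multiple recurrence theorem.**
If `(X, 𝒳, μ, T)` is a probability measure-preserving system and `A` is a measurable
set with `μ A > 0`, then for every `k` there is `n ≥ 1` with
`μ (A ∩ T⁻ⁿA ∩ T⁻²ⁿA ∩ ⋯ ∩ T⁻ᵏⁿA) > 0`. -/
theorem furstenberg_multiple_recurrence
    {X : Type*} [MeasurableSpace X] (μ : Measure X) [IsProbabilityMeasure μ]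
    (T : X → X) (hT : MeasurePreserving T μ μ)
    (A : Set X) (hA : MeasurableSet A) (hApos : 0 < μ A) (k : ℕ) :
    ∃ n : ℕ, 1 ≤ n ∧
      0 < μ (⋂ i ∈ Finset.range (k + 1), T^[i * n] ⁻¹' A) := by
  obtain ⟨N, hN⟩ := DensityHalesJewett.densityHJ (Fin (k + 1)) (μ.real A)
    (ENNReal.toReal_pos hApos.ne' (measure_ne_top μ A))
  let s (w : Fin N → Fin (k + 1)) : ℕ := ∑ i, (w i : ℕ)
  obtain ⟨l, hl⟩ : ∃ l : Combinatorics.Line (Fin (k + 1)) (Fin N),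
      μ (⋂ a, T^[s (l a)] ⁻¹' A) ≠ 0 := by
    by_contra! hnull
    obtain ⟨x, hx, hle⟩ := DensityHalesJewett.exists_le_dens_visits hT hA s
      (measure_iUnion_null hnull)
    obtain ⟨l, hl⟩ := hN (Fin N) (by simp) _ hle
    exact hx (Set.mem_iUnion.2 ⟨l, Set.mem_iInter.2 hl⟩)
  obtain ⟨b, n, hn, hs⟩ := DensityHalesJewett.sum_line l
  refine ⟨n, hn, pos_iff_ne_zero.2 ?_⟩
  have hmeas : MeasurableSet (⋂ i ∈ Finset.range (k + 1), T^[i * n] ⁻¹' A) :=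
    Finset.measurableSet_biInter _ fun i _ ↦ (hT.measurable.iterate _) hA
  rw [← (hT.iterate b).measure_preimage hmeas.nullMeasurableSet]
  convert hl using 2
  ext x
  simp only [s, hs, Set.mem_preimage, Set.mem_iInter, Finset.mem_range,
    Function.iterate_add_apply]
  exact ⟨fun h a ↦ h a a.2, fun h i hi ↦ h ⟨i, hi⟩⟩
end

section
/- Let k ≥ 2 be an integer and α ∈ ℝ be irrational, and let S_k = {n ∈ ℕ : {nᵏα} ∈ [1/4, 3/4]}, where {x} denotes the fractional part of x. Then S_k is a set of (k−1)-recurrence. -/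
open MeasureTheory

/-- `S` is a set of `k`-recurrence: for every probability measure-preserving system
`(X, 𝒳, μ, T)` and every measurable `A` with `μ A > 0`, there is `n ∈ S` with
`μ (A ∩ T⁻ⁿA ∩ ⋯ ∩ T⁻ᵏⁿA) > 0`. -/
def IsSetOfKRecurrence (k : ℕ) (S : Set ℕ) : Prop :=
  ∀ (X : Type) (_ : MeasurableSpace X) (μ : Measure X), IsProbabilityMeasure μ →
    ∀ T : X → X, MeasurePreserving T μ μ →
      ∀ A : Set X, MeasurableSet A → 0 < μ A →
        ∃ n ∈ S, 0 < μ (⋂ i ∈ Finset.range (k + 1), T^[i * n] ⁻¹' A)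

section

open Function Finset
open scoped BigOperators

namespace Combinatorics

namespace Subspace

variable {η ζ α β ι κ : Type*}

/-- A subspace of a subspace, seen as a subspace of the ambient cube. -/
def comp (V : Subspace η α ι) (W : Subspace ζ α η) : Subspace ζ α ι where
  idxFun i := (V.idxFun i).elim Sum.inl W.idxFun
  proper e := by
    obtain ⟨j, hj⟩ := W.proper e
    obtain ⟨i, hi⟩ := V.proper j
    exact ⟨i, by simp [hi, hj]⟩

lemma comp_apply (V : Subspace η α ι) (W : Subspace ζ α η) (x : ζ → α) :
    V.comp W x = V (W x) := by
  ext i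
  cases h : V.idxFun i <;> simp [comp, coe_apply, h]

/-- A line in a subspace, seen as a line of the ambient cube. -/
def compLine (V : Subspace η α ι) (l : Line α η) : Line α ι where
  idxFun i := (V.idxFun i).elim some l.idxFun
  proper := by
    obtain ⟨j, hj⟩ := l.proper
    obtain ⟨i, hi⟩ := V.proper j
    exact ⟨i, by simp [hi, hj]⟩

lemma compLine_apply (V : Subspace η α ι) (l : Line α η) (a : α) :
    V.compLine l a = V (l a) := by
  ext i
  cases h : V.idxFun i <;> simp [compLine, coe_apply, h]

/-- The product of two subspaces. -/
def prod (V : Subspace η α ι) (W : Subspace ζ α κ) : Subspace (η ⊕ ζ) α (ι ⊕ κ) where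
  idxFun := Sum.elim (fun i => (V.idxFun i).map id Sum.inl)
    (fun i => (W.idxFun i).map id Sum.inr)
  proper := by
    rintro (e | e)
    · obtain ⟨i, hi⟩ := V.proper e
      exact ⟨Sum.inl i, by simp [hi]⟩
    · obtain ⟨i, hi⟩ := W.proper e
      exact ⟨Sum.inr i, by simp [hi]⟩

lemma prod_apply (V : Subspace η α ι) (W : Subspace ζ α κ) (x : η ⊕ ζ → α) :
    V.prod W x = Sum.elim (V (x ∘ Sum.inl)) (W (x ∘ Sum.inr)) := by
  ext (i | i)
  · cases h : V.idxFun i <;> simp [prod, coe_apply, h]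
  · cases h : W.idxFun i <;> simp [prod, coe_apply, h]

/-- The product of a subspace and a point. -/
def horizontal (V : Subspace η α ι) (y : κ → α) : Subspace η α (ι ⊕ κ) where
  idxFun := Sum.elim V.idxFun (Sum.inl ∘ y)
  proper e := (V.proper e).elim fun i hi => ⟨Sum.inl i, hi⟩

lemma horizontal_apply (V : Subspace η α ι) (y : κ → α) (x : η → α) :
    V.horizontal y x = Sum.elim (V x) y := by
  ext (i | i) <;> rfl

/-- The product of a point and a subspace. -/
def vertical (y : κ → α) (V : Subspace η α ι) : Subspace η α (κ ⊕ ι) where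
  idxFun := Sum.elim (Sum.inl ∘ y) V.idxFun
  proper e := (V.proper e).elim fun i hi => ⟨Sum.inr i, hi⟩

lemma vertical_apply (y : κ → α) (V : Subspace η α ι) (x : η → α) :
    vertical y V x = Sum.elim y (V x) := by
  ext (i | i) <;> rfl

/-- The full subspace, with coordinates relabelled along an equivalence. -/
def ofEquiv (α : Type*) (e : η ≃ ι) : Subspace η α ι where
  idxFun i := Sum.inr (e.symm i)
  proper j := ⟨e j, by simp⟩

lemma ofEquiv_apply (e : η ≃ ι) (x : η → α) : ofEquiv α e x = x ∘ e.symm := rfl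

/-- Extend the alphabet of a subspace along a map. -/
def map (f : α → β) (V : Subspace η α ι) : Subspace η β ι where
  idxFun i := (V.idxFun i).map f id
  proper e := (V.proper e).imp fun i hi => by simp [hi]

lemma map_comp_apply (f : α → β) (V : Subspace η α ι) (x : η → α) :
    V.map f (f ∘ x) = f ∘ V x := by
  ext i
  cases h : V.idxFun i <;> simp [map, coe_apply, h]

lemma apply_injective (V : Subspace η α ι) : Injective (V : (η → α) → ι → α) := by
  intro x y hxy
  ext e
  obtain ⟨i, hi⟩ := V.proper e
  simpa [apply_inr hi] using congrFun hxy i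

lemma card_le [Fintype η] [Fintype ι] (V : Subspace η α ι) :
    Fintype.card η ≤ Fintype.card ι := by
  choose f hf using V.proper
  refine Fintype.card_le_of_injective f fun e e' h => ?_
  simpa [hf] using congrArg V.idxFun h

instance [Finite η] [Finite α] [Finite ι] : Finite (Subspace η α ι) :=
  Finite.of_injective idxFun fun _ _ h => Subspace.ext h

end Subspace

instance {α ι : Type*} [Finite α] [Finite ι] : Finite (Line α ι) :=
  Finite.of_injective Line.idxFun fun _ _ h => Line.ext h

/-- The density of a subset of a finite type. -/
noncomputable def density {X : Type*} [Fintype X] (A : Set X) : ℝ :=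
  𝔼 x, A.indicator 1 x

section density

variable {X Y : Type*} [Fintype X] [Fintype Y]

lemma density_nonneg (A : Set X) : 0 ≤ density A :=
  expect_nonneg fun x _ => Set.indicator_nonneg (by simp) x

lemma density_mono {A B : Set X} (h : A ⊆ B) : density A ≤ density B :=
  expect_le_expect fun _ _ => Set.indicator_le_indicator_of_subset h (by simp) _

lemma density_le_one (A : Set X) : density A ≤ 1 := by
  rcases isEmpty_or_nonempty X with h | h
  · simp [density]
  · exact expect_le univ_nonempty fun x _ => Set.indicator_le_self' (by simp) x

lemma density_univ [Nonempty X] : density (Set.univ : Set X) = 1 := by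
  simp [density]

lemma density_eq_ncard_div (A : Set X) : density A = A.ncard / Fintype.card X := by
  classical
  rw [density, Fintype.expect_eq_sum_div_card]
  congr 1
  simp [Set.indicator_apply, Set.ncard_eq_toFinset_card']

lemma nonempty_of_density_pos {A : Set X} (h : 0 < density A) : A.Nonempty := by
  by_contra hA
  simp [Set.not_nonempty_iff_eq_empty.1 hA, density] at h

lemma density_add_density_compl [Nonempty X] (A : Set X) : density A + density Aᶜ = 1 := by
  rw [density, density, ← expect_add_distrib]
  have (x : X) : A.indicator (1 : X → ℝ) x + Aᶜ.indicator 1 x = 1 := by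
    by_cases h : x ∈ A <;> simp [h]
  simp [this]

lemma density_preimage_equiv (e : X ≃ Y) (A : Set Y) : density (e ⁻¹' A) = density A :=
  Fintype.expect_equiv e _ _ fun _ => rfl

lemma density_iUnion_le {K : Type*} [Fintype K] (A : K → Set X) :
    density (⋃ k, A k) ≤ ∑ k, density (A k) := by
  simp only [density]
  rw [← expect_sum_comm]
  refine expect_le_expect fun x _ => ?_
  by_cases hx : x ∈ ⋃ k, A k
  · obtain ⟨k, hk⟩ := Set.mem_iUnion.1 hx
    rw [Set.indicator_of_mem hx]
    refine le_trans ?_ (single_le_sum (f := fun k => (A k).indicator (1 : X → ℝ) x)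
      (fun k _ => Set.indicator_nonneg (by simp) x) (mem_univ k))
    simp [hk]
  · rw [Set.indicator_of_notMem hx]
    exact sum_nonneg fun k _ => Set.indicator_nonneg (by simp) x

/-- Markov's inequality: a function bounded by `1` of large average is often large. -/
lemma half_le_density_of_le_expect [Nonempty X] {f : X → ℝ} {δ : ℝ} (hf : ∀ x, f x ≤ 1)
    (hδ : 0 ≤ δ) (h : δ ≤ 𝔼 x, f x) : δ / 2 ≤ density {x | δ / 2 ≤ f x} := by
  have key : 𝔼 x, f x ≤ 𝔼 x, ({x | δ / 2 ≤ f x}.indicator (1 : X → ℝ) x + δ / 2) := by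
    refine expect_le_expect fun x _ => ?_
    by_cases hx : δ / 2 ≤ f x
    · have := hf x
      simp only [Set.indicator_apply, Set.mem_ofPred_eq, hx, if_true, Pi.one_apply]
      linarith
    · simp only [Set.indicator_apply, Set.mem_ofPred_eq, hx, if_false]
      linarith
  rw [expect_add_distrib, Fintype.expect_const] at key
  simp only [density]
  linarith

lemma exists_density_ge_of_le_expect [Nonempty Y] {K : Type*} [Finite K] {δ : ℝ} (hδ : 0 < δ)
    (A : Y → Set X) (s : K → Set X) (hA : δ ≤ 𝔼 y, density (A y))
    (h : ∀ y, δ / 2 ≤ density (A y) → ∃ k, s k ⊆ A y) :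
    ∃ k, δ / 2 / (Nat.card K + 1) ≤ density {y | s k ⊆ A y} := by
  have := Fintype.ofFinite K
  have hm := half_le_density_of_le_expect (fun y => density_le_one (A y)) hδ.le hA
  have hsub : {y | δ / 2 ≤ density (A y)} ⊆ ⋃ k, {y | s k ⊆ A y} := fun y hy =>
    Set.mem_iUnion.2 (h y hy)
  by_contra! hcon
  have h1 := hm.trans ((density_mono hsub).trans (density_iUnion_le _))
  have h2 : ∑ k, density {y | s k ⊆ A y} ≤ ∑ _k : K, δ / 2 / (Nat.card K + 1) :=
    sum_le_sum fun k _ => (hcon k).le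
  rw [sum_const, card_univ, nsmul_eq_mul, Nat.card_eq_fintype_card] at h2
  have h3 : (Fintype.card K : ℝ) * (δ / 2 / (Fintype.card K + 1)) < δ / 2 := by
    rw [← mul_div_assoc, div_lt_iff₀ (by positivity)]
    linarith
  linarith

lemma expect_sumElim {ι κ α : Type*} [Fintype ι] [Fintype κ] [Fintype α]
    [DecidableEq ι] [DecidableEq κ] (f : (ι ⊕ κ → α) → ℝ) :
    𝔼 z, f z = 𝔼 x : ι → α, 𝔼 y : κ → α, f (Sum.elim x y) := by
  rw [← expect_product', univ_product_univ]
  exact Fintype.expect_equiv (Equiv.sumArrowEquivProdArrow ι κ α) _ _ fun z => by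
    simp [Equiv.sumArrowEquivProdArrow]

lemma density_eq_expect_sumElim {ι κ α : Type*} [Fintype ι] [Fintype κ] [Fintype α]
    [DecidableEq ι] [DecidableEq κ] (A : Set (ι ⊕ κ → α)) :
    density A = 𝔼 x : ι → α, density {y : κ → α | Sum.elim x y ∈ A} := by
  rw [density, expect_sumElim]
  rfl

end density

/-- An index type with at least `m + n` elements splits into one of size `m` and one of size at
least `n`. -/
lemma exists_sum_equiv {ι κ : Type*} [Fintype ι] [Fintype κ] {n : ℕ}
    (h : Fintype.card κ + n ≤ Fintype.card ι) :
    ∃ m, n ≤ m ∧ Nonempty (κ ⊕ Fin m ≃ ι) :=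
  ⟨Fintype.card ι - Fintype.card κ, by omega, ⟨Fintype.equivOfCardEq (by simp; omega)⟩⟩

/-- Every subset of density at least `δ` of a cube of large enough dimension over the alphabet `α`
contains a combinatorial line. -/
def DensityHalesJewettAt (α : Type) [Fintype α] (δ : ℝ) : Prop :=
  ∃ n : ℕ, ∀ (ι : Type) [Fintype ι] [DecidableEq ι], n ≤ Fintype.card ι →
    ∀ A : Set (ι → α), δ ≤ density A → ∃ l : Line α ι, ∀ a, l a ∈ A

/-- The density Hales-Jewett property of an alphabet. -/
def DensityHalesJewett (α : Type) [Fintype α] : Prop :=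
  ∀ δ : ℝ, 0 < δ → DensityHalesJewettAt α δ

section

variable {α : Type} [Fintype α]

lemma density_ofEquiv_preimage {η ι : Type} [Fintype η] [DecidableEq η] [Fintype ι]
    [DecidableEq ι] (e : η ≃ ι) (A : Set (ι → α)) :
    density (Subspace.ofEquiv α e ⁻¹' A) = density A :=
  density_preimage_equiv (e.arrowCongr (Equiv.refl α)) A

/-- Multidimensional version of the density Hales-Jewett property. -/
theorem DensityHalesJewett.exists_subspace [Nonempty α] (h : DensityHalesJewett α) (m : ℕ) {δ : ℝ}
    (hδ : 0 < δ) :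
    ∃ n : ℕ, ∀ (ι : Type) [Fintype ι] [DecidableEq ι], n ≤ Fintype.card ι →
      ∀ A : Set (ι → α), δ ≤ density A →
        ∃ V : Subspace (Fin m) α ι, ∀ x, V x ∈ A := by
  induction m generalizing δ with
  | zero =>
    refine ⟨0, fun ι _ _ _ A hA => ?_⟩
    obtain ⟨x, hx⟩ := nonempty_of_density_pos (hδ.trans_le hA)
    exact ⟨⟨fun i => Sum.inl (x i), fun e => e.elim0⟩, fun _ => hx⟩
  | succ m ih =>
    obtain ⟨n₁, hn₁⟩ := h (δ / 2) (half_pos hδ)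
    obtain ⟨n₂, hn₂⟩ := ih (δ := δ / 2 / (Nat.card (Line α (Fin n₁)) + 1)) (by positivity)
    refine ⟨n₁ + n₂, fun ι _ _ hι A hA => ?_⟩
    obtain ⟨n, hn, ⟨e⟩⟩ := exists_sum_equiv (κ := Fin n₁) (n := n₂) (by simpa using hι)
    let B : Set (Fin n₁ ⊕ Fin n → α) := Subspace.ofEquiv α e ⁻¹' A
    have hB : δ ≤ 𝔼 y : Fin n → α, density {x : Fin n₁ → α | Sum.elim x y ∈ B} := by
      have : density B = density A := density_ofEquiv_preimage e A
      rw [← this, density_eq_expect_sumElim] at hA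
      refine hA.trans_eq ?_
      simp only [density]
      exact expect_comm _ _ _
    obtain ⟨l, hl⟩ := exists_density_ge_of_le_expect hδ _ (fun l : Line α (Fin n₁) => Set.range l)
      hB fun y hy => (hn₁ (Fin n₁) (by simp) _ hy).imp fun l hl => Set.range_subset_iff.2 hl
    obtain ⟨V, hV⟩ := hn₂ (Fin n) (by simpa using hn) _ hl
    refine ⟨(Subspace.ofEquiv α e).comp ((l.toSubspaceUnit.prod V).comp
      (Subspace.ofEquiv α (Fintype.equivOfCardEq (by simp [add_comm])))), fun x => ?_⟩
    rw [Subspace.comp_apply, Subspace.comp_apply, Subspace.prod_apply, Line.toSubspaceUnit_apply]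
    exact hV _ ⟨_, rfl⟩

/-- Probabilistic version of the density Hales-Jewett property. -/
theorem DensityHalesJewett.exists_line_density_ge [Nonempty α] (h : DensityHalesJewett α) {δ : ℝ}
    (hδ : 0 < δ) :
    ∃ n : ℕ, ∀ (ι : Type) [Fintype ι] [DecidableEq ι], n ≤ Fintype.card ι → ∃ θ > 0,
      ∀ (Y : Type) [Fintype Y] [Nonempty Y] (B : (ι → α) → Set Y), (∀ w, δ ≤ density (B w)) →
        ∃ l : Line α ι, θ ≤ density {y | ∀ a, y ∈ B (l a)} := by
  obtain ⟨n, hn⟩ := h (δ / 2) (half_pos hδ)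
  refine ⟨n, fun ι _ _ hι => ?_⟩
  refine ⟨δ / 2 / (Nat.card (Line α ι) + 1), by positivity, fun Y _ _ B hB => ?_⟩
  obtain ⟨l, hl⟩ := exists_density_ge_of_le_expect hδ (fun y => {w | y ∈ B w})
    (fun l : Line α ι => Set.range l) (by
      refine (le_expect univ_nonempty fun w _ => hB w).trans_eq ?_
      simp only [density]
      exact expect_comm _ _ _)
    fun y hy => (hn ι hι _ hy).imp fun l hl => Set.range_subset_iff.2 hl
  refine ⟨l, hl.trans_eq ?_⟩
  congr 1
  ext y
  simp [Set.range_subset_iff]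

/-- Any colouring of lines is constant, on a suitable subspace of a large cube, along all lines
that have a given word (with a variable) as first coordinates. -/
theorem exists_subspace_color_eq (α : Type) [Finite α] (n : ℕ) (η : Type) [Finite η]
    (κ : Type) [Finite κ] :
    ∃ (J : Type) (_ : Fintype J) (_ : DecidableEq J) (ι : Type) (_ : Fintype ι)
      (_ : DecidableEq ι), Fintype.card J = n ∧
      ∀ c : Line α ι → κ, ∃ V : Subspace (J ⊕ η) α ι, ∀ l l' : Line α (J ⊕ η),
        (∀ j, l.idxFun (Sum.inl j) = l'.idxFun (Sum.inl j)) →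
        (∃ j, l.idxFun (Sum.inl j) = none) → c (V.compLine l) = c (V.compLine l') := by
  classical
  induction n generalizing κ with
  | zero =>
    have := Fintype.ofFinite η
    exact ⟨Fin 0, inferInstance, inferInstance, Fin 0 ⊕ η, inferInstance, inferInstance, rfl,
      fun c => ⟨default, fun l l' _ h => h.elim fun j => j.elim0⟩⟩
  | succ n ih =>
    obtain ⟨J, _, _, ι₃, _, _, hJ, hι₃⟩ := ih (α → κ)
    obtain ⟨ι₂, _, hι₂⟩ := Subspace.exists_mono_in_high_dimension (Option α) κ ι₃
    refine ⟨Option J, inferInstance, inferInstance, Option ι₂, inferInstance, inferInstance,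
      by simp [hJ], fun c => ?_⟩
    obtain ⟨W, col, hW⟩ := hι₂ fun w => c ⟨fun i => i.elim none w, none, rfl⟩
    let V₁ : Subspace (Option ι₃) α (Option ι₂) :=
      { idxFun := fun i => i.elim (Sum.inr none) fun i =>
          (W.idxFun i).elim (fun b => b.elim (Sum.inr none) Sum.inl) (fun e => Sum.inr (some e))
        proper := by
          rintro (_ | e)
          · exact ⟨none, rfl⟩
          · obtain ⟨i, hi⟩ := W.proper e
            exact ⟨some i, by simp [hi]⟩ }
    let cons (a : α) (l : Line α ι₃) : Line α (Option ι₃) :=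
      ⟨fun i => i.elim (some a) l.idxFun, l.proper.imp' some fun _ => id⟩
    obtain ⟨V₂, hV₂⟩ := hι₃ fun l a => c (V₁.compLine (cons a l))
    let V₃ : Subspace (Option J ⊕ η) α (Option ι₃) :=
      { idxFun := fun i => i.elim (Sum.inr (Sum.inl none)) fun i =>
          (V₂.idxFun i).map id (Sum.map some id)
        proper := by
          rintro ((_ | j) | e)
          · exact ⟨none, rfl⟩
          · obtain ⟨i, hi⟩ := V₂.proper (Sum.inl j)
            exact ⟨some i, by simp [hi]⟩
          · obtain ⟨i, hi⟩ := V₂.proper (Sum.inr e)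
            exact ⟨some i, by simp [hi]⟩ }
    -- lines whose first letter is variable all get the colour `col`
    have hcol (l : Line α (Option J ⊕ η)) (hl : l.idxFun (Sum.inl none) = none) :
        c ((V₁.comp V₃).compLine l) = col := by
      rw [← hW (fun i => (V₃.compLine l).idxFun (some i))]
      congr 1
      ext1
      funext i
      rcases i with _ | i
      · simp [V₁, V₃, Subspace.compLine, Subspace.comp, hl]
      · rcases h : W.idxFun i with (_ | b) | e
        · simp [V₁, V₃, Subspace.compLine, Subspace.comp, h, hl, Subspace.coe_apply]
        · simp [V₁, V₃, Subspace.compLine, Subspace.comp, h, Subspace.coe_apply]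
        · rcases h' : V₂.idxFun e with b | (j | e') <;>
          simp [V₁, V₃, Subspace.compLine, Subspace.comp, h, h', Subspace.coe_apply]
    refine ⟨V₁.comp V₃, fun l l' hll' hl => ?_⟩
    rcases h0 : l.idxFun (Sum.inl none) with _ | a
    · rw [hcol l h0, hcol l' ((hll' none).symm.trans h0)]
    · have h0' : l'.idxFun (Sum.inl none) = some a := (hll' none).symm.trans h0
      obtain ⟨_ | j, hj⟩ := hl
      · simp [h0] at hj
      have tail (l : Line α (Option J ⊕ η)) (h0 : l.idxFun (Sum.inl none) = some a)
          (hj : l.idxFun (Sum.inl (some j)) = none) :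
          (V₁.comp V₃).compLine l = V₁.compLine (cons a (V₂.compLine
            ⟨fun i => l.idxFun (i.map some id), Sum.inl j, hj⟩)) := by
        have : V₃.compLine l = cons a (V₂.compLine
            ⟨fun i => l.idxFun (i.map some id), Sum.inl j, hj⟩) := by
          ext1
          funext i
          rcases i with _ | i
          · simp [V₃, cons, Subspace.compLine, h0]
          · rcases h' : V₂.idxFun i with b | (j | e') <;>
            simp [V₃, cons, Subspace.compLine, h']
        rw [← this]
        ext1
        funext i
        cases h : V₁.idxFun i <;> simp [Subspace.compLine, Subspace.comp, h]
      rw [tail l h0 hj, tail l' h0' ((hll' _).symm.trans hj)]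
      refine congrFun (hV₂ _ _ ?_ ⟨j, hj⟩) a
      intro j'
      exact hll' (some j')

end

lemma density_pi {ι β : Type*} [Fintype ι] [DecidableEq ι] [Fintype β] (t : ι → Finset β) :
    density {z : ι → β | ∀ i, z i ∈ t i} = ∏ i, (#(t i) / Fintype.card β : ℝ) := by
  have : {z : ι → β | ∀ i, z i ∈ t i} = (Fintype.piFinset t : Set (ι → β)) := by
    ext z
    simp
  rw [this, density_eq_ncard_div, Set.ncard_coe_finset, Fintype.card_piFinset, Fintype.card_fun]
  simp [Finset.prod_div_distrib]

section

variable {α : Type} {ι : Type*}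

/-- Replace the extra letter of the alphabet `Option α` by the letter `a`. -/
def collapse (a : α) (z : ι → Option α) : ι → α := fun i => (z i).getD a

variable [Fintype α] [Fintype ι] [DecidableEq ι]

/-- The word over `Option α` which is given by `u` on `S` and is `none` elsewhere. -/
def extendNone (S : Finset ι) (u : S → α) : ι → Option α :=
  fun i => if h : i ∈ S then some (u ⟨i, h⟩) else none

lemma sum_filter_support_eq (S : Finset ι) (f : (ι → Option α) → ℝ) :
    ∑ z with univ.filter (fun i => (z i).isSome) = S, f z =
      ∑ u : S → α, f (extendNone S u) := by
  symm
  refine sum_bij (fun u _ => extendNone S u) ?_ ?_ ?_ (fun _ _ => rfl)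
  · intro u _
    simp only [mem_filter, mem_univ, true_and]
    ext i
    by_cases h : i ∈ S <;> simp [extendNone, h]
  · intro u _ v _ huv
    ext ⟨i, hi⟩
    simpa [extendNone, hi] using congrFun huv i
  · intro z hz
    simp only [mem_filter, mem_univ, true_and] at hz
    have h (i : S) : (z i).isSome := by
      have := i.2
      simpa [← hz] using this
    refine ⟨fun i => (z i).get (h i), mem_univ _, ?_⟩
    ext1 i
    by_cases hi : i ∈ S
    · simp [extendNone, hi]
    · have : z i = none := by simpa [← hz] using hi
      simp [extendNone, hi, this]

end

lemma exists_density_support_card_lt {α : Type} [Fintype α] [Nonempty α] (m : ℕ) {ε : ℝ}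
    (hε : 0 < ε) :
    ∃ (ι : Type) (_ : Fintype ι) (_ : DecidableEq ι),
      density {z : ι → Option α | #(univ.filter fun i => (z i).isSome) < m} < ε := by
  obtain ⟨L, hL⟩ : ∃ L : ℕ, (1 / 2 : ℝ) ^ L < ε / (m + 1) :=
    exists_pow_lt_of_lt_one (by positivity) (by norm_num)
  refine ⟨Fin m × Fin L, inferInstance, inferInstance, ?_⟩
  let R (j : Fin m) : Set (Fin m × Fin L → Option α) :=
    {z | ∀ i, z i ∈ if i.1 = j then {none} else (univ : Finset (Option α))}
  have hsub : {z : Fin m × Fin L → Option α | #(univ.filter fun i => (z i).isSome) < m} ⊆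
      ⋃ j, R j := by
    intro z hz
    by_contra hcon
    have h (j : Fin m) : ∃ l, (z (j, l)).isSome := by
      by_contra! hj
      refine hcon (Set.mem_iUnion.2 ⟨j, fun ⟨j', l⟩ => ?_⟩)
      by_cases h : j' = j
      · subst h
        simpa using hj l
      · simp [h]
    choose f hf using h
    have : Fintype.card (Fin m) ≤ #(univ.filter fun i => (z i).isSome) := by
      rw [← card_univ]
      refine card_le_card_of_injOn (fun j => (j, f j)) (fun j _ => by simp [hf]) ?_
      intro j _ j' _ h
      exact (Prod.ext_iff.1 h).1
    simp only [Set.mem_ofPred_eq, Fintype.card_fin] at hz this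
    omega
  have hR (j : Fin m) : density (R j) ≤ (1 / 2 : ℝ) ^ L := by
    rw [density_pi, Fintype.prod_prod_type, ← mul_prod_erase _ _ (mem_univ j)]
    have h1 : ∏ j' ∈ univ.erase j, ∏ l : Fin L,
        (#(if (j', l).1 = j then {none} else (univ : Finset (Option α))) /
          Fintype.card (Option α) : ℝ) = 1 := by
      refine prod_eq_one fun j' hj' => prod_eq_one fun l _ => ?_
      simp only [(mem_erase.1 hj').1, if_false, card_univ]
      exact div_self (by positivity)
    rw [h1, mul_one]
    simp only [if_true, card_singleton, prod_const, card_univ, Fintype.card_fin,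
      Fintype.card_option]
    have h2 : (1 : ℝ) ≤ Fintype.card α := by exact_mod_cast Fintype.card_pos
    push_cast
    gcongr
    linarith
  calc density _ ≤ ∑ j, density (R j) := (density_mono hsub).trans (density_iUnion_le _)
    _ ≤ ∑ _j : Fin m, (1 / 2 : ℝ) ^ L := sum_le_sum fun j _ => hR j
    _ = m * (1 / 2 : ℝ) ^ L := by simp
    _ ≤ (m + 1) * (1 / 2 : ℝ) ^ L := by gcongr; linarith
    _ < (m + 1) * (ε / (m + 1)) := by gcongr
    _ = ε := by field_simp

section

variable {α : Type} [Fintype α] [Nonempty α]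

/-- A dense set which does not distinguish the letters `a` and `none` contains a subspace. -/
theorem DensityHalesJewett.exists_subspace_insensitive (h : DensityHalesJewett α) (a : α)
    (ζ : Type) [Fintype ζ] {ε : ℝ} (hε : 0 < ε) :
    ∃ (ι : Type) (_ : Fintype ι) (_ : DecidableEq ι), ∀ E : Set (ι → α),
      ε ≤ density {z | collapse a z ∈ E} →
        ∃ V : Subspace ζ (Option α) ι, ∀ z, collapse a (V z) ∈ E := by
  obtain ⟨m, hm⟩ := h.exists_subspace (Fintype.card ζ) (half_pos hε)
  obtain ⟨ι, _, _, hι⟩ := exists_density_support_card_lt (α := α) m (half_pos hε)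
  refine ⟨ι, inferInstance, inferInstance, fun E hE => ?_⟩
  obtain ⟨S, hmS, hS⟩ : ∃ S : Finset ι, m ≤ #S ∧
      ε / 2 ≤ density {u : S → α | collapse a (extendNone S u) ∈ E} := by
    by_contra! hcon
    set F := {z : ι → Option α | collapse a z ∈ E} with hF
    set bad := {z : ι → Option α | #(univ.filter fun i => (z i).isSome) < m} with hbad
    have key : ∑ z, (F.indicator 1 z - ε / 2 - bad.indicator 1 z : ℝ) ≤ 0 := by
      rw [← sum_fiberwise univ (fun z : ι → Option α => univ.filter fun i => (z i).isSome)]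
      refine sum_nonpos fun S _ => ?_
      rcases lt_or_ge #S m with hS | hS
      · refine sum_nonpos fun z hz => ?_
        have hz' : z ∈ bad := by
          simp only [mem_filter, mem_univ, true_and] at hz
          simpa [hbad, hz] using hS
        have : F.indicator (1 : (ι → Option α) → ℝ) z ≤ 1 := Set.indicator_le_self' (by simp) z
        rw [Set.indicator_of_mem hz', Pi.one_apply]
        linarith
      · rw [sum_filter_support_eq S (fun z => (F.indicator 1 z - ε / 2 - bad.indicator 1 z : ℝ))]
        have h1 := hcon S hS
        rw [density, Fintype.expect_eq_sum_div_card, div_lt_iff₀ (by positivity)] at h1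
        have h2 : ∑ u : S → α, (F.indicator 1 (extendNone S u) - ε / 2 -
            bad.indicator 1 (extendNone S u) : ℝ) ≤
            ∑ u : S → α, ({u : S → α | collapse a (extendNone S u) ∈ E}.indicator 1 u - ε / 2) := by
          refine sum_le_sum fun u _ => ?_
          have : 0 ≤ bad.indicator (1 : (ι → Option α) → ℝ) (extendNone S u) :=
            Set.indicator_nonneg (by simp) _
          have h3 : F.indicator (1 : (ι → Option α) → ℝ) (extendNone S u) =
            {u : S → α | collapse a (extendNone S u) ∈ E}.indicator 1 u := rfl
          linarith
        refine h2.trans ?_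
        rw [sum_sub_distrib, sum_const, card_univ, nsmul_eq_mul]
        linarith
    have : 𝔼 z, (F.indicator 1 z - ε / 2 - bad.indicator 1 z : ℝ) ≤ 0 := by
      rw [Fintype.expect_eq_sum_div_card]
      exact div_nonpos_of_nonpos_of_nonneg key (by positivity)
    rw [expect_sub_distrib, expect_sub_distrib, Fintype.expect_const] at this
    simp only [density] at hE hι
    linarith
  obtain ⟨V, hV⟩ := hm S (by simpa using hmS) _ hS
  have e : Fin (Fintype.card ζ) ≃ ζ := (Fintype.equivFin ζ).symm
  refine ⟨⟨fun i => if h : i ∈ S then (V.idxFun ⟨i, h⟩).map some e else Sum.inl none,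
    fun d => ?_⟩, fun z => ?_⟩
  · obtain ⟨i, hi⟩ := V.proper (e.symm d)
    exact ⟨i, by simp [hi]⟩
  · have := hV (collapse a z ∘ e)
    simp only [Set.mem_ofPred_eq] at this
    convert this using 1
    ext i
    by_cases h : i ∈ S
    · rcases h' : V.idxFun ⟨i, h⟩ <;> simp [collapse, extendNone, Subspace.coe_apply, h, h']
    · simp [collapse, extendNone, Subspace.coe_apply, h]

end

section

lemma collapse_sumElim {α : Type} {ι κ : Type*} (a : α) (x : ι → Option α) (y : κ → Option α) :
    collapse a (Sum.elim x y) = Sum.elim (collapse a x) (collapse a y) := by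
  ext (i | i) <;> rfl

variable {α : Type} [Fintype α] [Nonempty α]

/-- If a set which does not distinguish the letters `a` and `none` has an average density at least
`ε / 2`, many fibres contain the same subspace. -/
lemma exists_subspace_density_fiber_ge {a : α} {ζ ι₀ : Type} [Fintype ζ] [Fintype ι₀]
    [DecidableEq ι₀] {ε : ℝ} (hε : 0 < ε) (hε1 : ε ≤ 1)
    (h₀ : ∀ E : Set (ι₀ → α), ε / 2 / 2 ≤ density {z | collapse a z ∈ E} →
        ∃ V : Subspace ζ (Option α) ι₀, ∀ z, collapse a (V z) ∈ E)
    {ι : Type} [Fintype ι] [DecidableEq ι] (E : Set (ι₀ ⊕ ι → α)) :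
    ∃ V : Subspace ζ (Option α) ι₀, ε / 2 ≤ density {z | collapse a z ∈ E} →
      ε / 2 / 2 / (Nat.card (Subspace ζ (Option α) ι₀) + 1) ≤
        density {y : ι → Option α | ∀ z, Sum.elim (collapse a (V z)) (collapse a y) ∈ E} := by
  by_cases hE : ε / 2 ≤ density {z | collapse a z ∈ E}
  · obtain ⟨V, hV⟩ := exists_density_ge_of_le_expect (half_pos hε)
      (fun y : ι → Option α => {x : ι₀ → Option α | collapse a (Sum.elim x y) ∈ E})
      (fun V : Subspace ζ (Option α) ι₀ => Set.range V) (by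
        rw [density_eq_expect_sumElim] at hE
        refine hE.trans_eq ?_
        simp only [density]
        exact expect_comm _ _ _)
      (fun y hy => by
        simp only [collapse_sumElim] at hy ⊢
        exact (h₀ {x | Sum.elim x (collapse a y) ∈ E} hy).imp fun V hV =>
          Set.range_subset_iff.2 hV)
    refine ⟨V, fun _ => hV.trans_eq ?_⟩
    congr 1
    ext y
    simp [Set.range_subset_iff, collapse_sumElim]
  · obtain ⟨V, -⟩ := h₀ Set.univ ((by linarith : ε / 2 / 2 ≤ 1).trans_eq density_univ.symm)
    exact ⟨V, fun h => (hE h).elim⟩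

/-- Exhaustion of families of sets which do not distinguish `a` and `none` by subspaces: a function
of nonpositive average on all `ζ`-dimensional subspaces inside these sets has small average on
them. The number `r` controls the number of rounds that are needed. -/
theorem DensityHalesJewett.exists_expect_indicator_le (h : DensityHalesJewett α) (a : α)
    (ζ : Type) [Fintype ζ] [DecidableEq ζ] {ε : ℝ} (hε : 0 < ε) (hε1 : ε ≤ 1) :
    ∃ c > 0, ∀ r : ℕ, ∃ (ι : Type) (_ : Fintype ι) (_ : DecidableEq ι),
      ∀ (X : Type) [Fintype X] [Nonempty X] (E : X → Set (ι → α))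
        (g : X → (ι → Option α) → ℝ), (∀ x z, g x z ≤ 1) →
        (∀ x (V : Subspace ζ (Option α) ι), (∀ z, collapse a (V z) ∈ E x) →
          𝔼 z, g x (V z) ≤ 0) →
        𝔼 x, density {z | collapse a z ∈ E x} ≤ r * c + ε →
        𝔼 x, 𝔼 z, {z | collapse a z ∈ E x}.indicator (g x) z ≤ ε := by
  obtain ⟨ι₀, _, _, h₀⟩ := h.exists_subspace_insensitive a ζ (half_pos (half_pos hε))
  set κ := ε / 2 / 2 / (Nat.card (Subspace ζ (Option α) ι₀) + 1 : ℝ) with hκ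
  have hκ0 : 0 < κ := by positivity
  set Q : ℝ := ((Fintype.card (ι₀ → Option α) : ℕ) : ℝ) with hQ
  have hQ0 : 0 < Q := by rw [hQ]; positivity
  refine ⟨κ / Q * (ε / 2), by positivity, fun r => ?_⟩
  induction r with
  | zero =>
    refine ⟨Fin 0, inferInstance, inferInstance, fun X _ _ E g hg _ hE => ?_⟩
    refine le_trans (expect_le_expect fun x _ => expect_le_expect fun z _ => ?_)
      (hE.trans_eq (by simp))
    exact Set.indicator_le_indicator (hg x z)
  | succ r ih =>
    obtain ⟨ι, _, _, hι⟩ := ih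
    refine ⟨ι₀ ⊕ ι, inferInstance, inferInstance, fun X _ _ E g hg hV hE => ?_⟩
    by_cases hsmall : 𝔼 x, density {z | collapse a z ∈ E x} ≤ ε
    · refine le_trans (expect_le_expect fun x _ => expect_le_expect fun z _ => ?_) hsmall
      exact Set.indicator_le_indicator (hg x z)
    push Not at hsmall
    choose W hW using fun x => exists_subspace_density_fiber_ge hε hε1 h₀ (E x)
    set E' : X → Set (ι → α) := fun x => {v | ∀ z, Sum.elim (collapse a (W x z)) v ∈ E x}
    set G : X → Set (ι → Option α) := fun x => {y | collapse a y ∈ E' x} with hG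
    set F : X → Set (ι₀ ⊕ ι → Option α) := fun x => {z | collapse a z ∈ E x} with hF
    -- what remains, fibre by fibre, after removal of `range (W x) × G x`
    let E'' : X × (ι₀ → Option α) → Set (ι → α) := fun p =>
      {v | Sum.elim (collapse a p.2) v ∈ E p.1 ∧ ¬ (p.2 ∈ Set.range (W p.1) ∧ v ∈ E' p.1)}
    have hmem (x : X) (u : ι₀ → Option α) (y : ι → Option α) :
        u ∈ Set.range (W x) → y ∈ G x → Sum.elim u y ∈ F x := by
      rintro ⟨z, rfl⟩ hy
      simp only [hF, Set.mem_ofPred_eq, collapse_sumElim]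
      exact hy z
    have hsplit (f : (ι₀ ⊕ ι → Option α) → ℝ) (x : X) :
        𝔼 z, (F x).indicator f z = (𝔼 u, 𝔼 y, {y | collapse a y ∈ E'' (x, u)}.indicator
            (fun y => f (Sum.elim u y)) y) +
          𝔼 u, 𝔼 y, (Set.range (W x)).indicator (fun u => (G x).indicator
            (fun y => f (Sum.elim u y)) y) u := by
      rw [expect_sumElim, ← expect_add_distrib]
      refine expect_congr rfl fun u _ => ?_
      rw [← expect_add_distrib]
      refine expect_congr rfl fun y _ => ?_
      have hm := hmem x u y
      have hiff : y ∈ {y | collapse a y ∈ E'' (x, u)} ↔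
          Sum.elim u y ∈ F x ∧ ¬ (u ∈ Set.range (W x) ∧ y ∈ G x) := by
        simp only [E'', hF, hG, Set.mem_ofPred_eq, collapse_sumElim]
      classical
      simp only [Set.indicator_apply, hiff]
      by_cases h1 : u ∈ Set.range (W x) <;> by_cases h2 : y ∈ G x
      · simp only [h1, h2, hm h1 h2, not_true, and_true, and_false, if_true, if_false, zero_add]
      all_goals simp only [h1, h2, not_false_eq_true, and_true, and_false, if_true,
        if_false, add_zero]
    have hrange (f : (ι₀ → Option α) → ℝ) (x : X) :
        𝔼 u, (Set.range (W x)).indicator f u = (∑ z, f (W x z)) / Q := by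
      classical
      rw [Fintype.expect_eq_sum_div_card, ← sum_image (g := W x) (f := f) fun z _ z' _ h =>
        (W x).apply_injective h]
      congr 1
      rw [← sum_indicator_subset _ (subset_univ (univ.image (W x)))]
      simp
    have hgood : 𝔼 x, 𝔼 u, 𝔼 y, (Set.range (W x)).indicator (fun u => (G x).indicator
            (fun y => g x (Sum.elim u y)) y) u ≤ 0 := by
      refine expect_le univ_nonempty fun x _ => ?_
      rw [expect_comm]
      refine expect_le univ_nonempty fun y _ => ?_
      rw [hrange]
      refine div_nonpos_of_nonpos_of_nonneg ?_ hQ0.le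
      by_cases hy : y ∈ G x
      · have := hV x ((W x).horizontal y) fun z => by
          rw [Subspace.horizontal_apply]
          exact hmem x _ y ⟨z, rfl⟩ hy
        rw [Fintype.expect_eq_sum_div_card] at this
        simp only [hy, Set.indicator_of_mem]
        simp only [Subspace.horizontal_apply] at this
        by_contra! hpos
        exact absurd this (not_le.2 (by positivity))
      · simp [hy]
    have hdens : 𝔼 x, density (F x) ≥
        (𝔼 p : X × (ι₀ → Option α), density {y | collapse a y ∈ E'' p}) + κ / Q * (ε / 2) := by
      have h1 : 𝔼 x, density (F x) = (𝔼 p : X × (ι₀ → Option α),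
          density {y | collapse a y ∈ E'' p}) + 𝔼 x, 𝔼 u, 𝔼 y, (Set.range (W x)).indicator
            (fun u => (G x).indicator (fun _ => 1) y) u := by
        rw [← univ_product_univ, expect_product, ← expect_add_distrib]
        exact expect_congr rfl fun x _ => hsplit 1 x
      have h2 : ε / 2 ≤ density {x | ε / 2 ≤ density (F x)} :=
        half_le_density_of_le_expect (fun x => density_le_one _) hε.le hsmall.le
      have h3 : κ / Q * (ε / 2) ≤ 𝔼 x, 𝔼 u, 𝔼 y, (Set.range (W x)).indicator
            (fun u => (G x).indicator (fun _ => (1 : ℝ)) y) u := by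
        calc κ / Q * (ε / 2) ≤ κ / Q * density {x | ε / 2 ≤ density (F x)} := by gcongr
          _ = 𝔼 x, κ / Q * {x | ε / 2 ≤ density (F x)}.indicator 1 x := by
            rw [density, mul_expect]
          _ ≤ _ := by
            refine expect_le_expect fun x _ => ?_
            rw [expect_comm]
            simp only [hrange]
            by_cases hx : ε / 2 ≤ density (F x)
            · have hcard : (1 : ℝ) ≤ Fintype.card (ζ → Option α) := by
                exact_mod_cast Fintype.card_pos
              have hGx : κ ≤ density (G x) := hW x hx
              simp only [sum_const, card_univ, nsmul_eq_mul, ← expect_div, ← mul_expect]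
              rw [Set.indicator_of_mem (by exact hx), Pi.one_apply, mul_one]
              gcongr
              exact hGx.trans (le_mul_of_one_le_left (density_nonneg _) hcard)
            · rw [Set.indicator_of_notMem (by exact hx), mul_zero]
              refine expect_nonneg fun y _ => div_nonneg (sum_nonneg fun z _ => ?_) hQ0.le
              exact Set.indicator_nonneg (fun _ _ => zero_le_one) _
      linarith
    have hrest := hι (X × (ι₀ → Option α)) E'' (fun p y => g p.1 (Sum.elim p.2 y))
      (fun p y => hg _ _) (fun p V hp => by
        have := hV p.1 (Subspace.vertical p.2 V) fun z => by
          rw [Subspace.vertical_apply, collapse_sumElim]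
          exact (hp z).1
        simpa only [Subspace.vertical_apply] using this) (by
        push_cast at hE
        linarith)
    rw [← univ_product_univ, expect_product] at hrest
    refine (expect_congr rfl fun x _ => hsplit (g x) x).trans_le ?_
    rw [expect_add_distrib]
    linarith

lemma Subspace.collapse_apply {α : Type} {η ι : Type*} (V : Subspace η (Option α) ι) (a : α)
    (z : η → Option α) :
    collapse a (V z) = V.map (fun o => o.getD a) (collapse a z) :=
  (V.map_comp_apply (fun o : Option α => o.getD a) z).symm

/-- A function whose average over a set not distinguishing `a` and `none` is not small has
positive average on a subspace inside this set. -/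
lemma DensityHalesJewett.exists_subspace_of_lt_expect (h : DensityHalesJewett α) (a : α)
    (ζ : Type) [Fintype ζ] [DecidableEq ζ] {ε : ℝ} (hε : 0 < ε) :
    ∃ (ι : Type) (_ : Fintype ι) (_ : DecidableEq ι),
      ∀ (E : Set (ι → α)) (g : (ι → Option α) → ℝ), (∀ z, g z ≤ 1) →
        ε < 𝔼 z, {z | collapse a z ∈ E}.indicator g z →
        ∃ V : Subspace ζ (Option α) ι, (∀ z, collapse a (V z) ∈ E) ∧ 0 < 𝔼 z, g (V z) := by
  obtain ⟨c, hc, hr⟩ := h.exists_expect_indicator_le a ζ (lt_min hε one_pos) (min_le_right ε 1)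
  obtain ⟨r, hrc⟩ := exists_nat_ge (1 / c)
  obtain ⟨ι, _, _, hι⟩ := hr r
  refine ⟨ι, inferInstance, inferInstance, fun E g hg hE => ?_⟩
  by_contra! hcon
  have := hι Unit (fun _ => E) (fun _ => g) (fun _ => hg) (fun _ V hV => hcon V hV) (by
    rw [Fintype.expect_const]
    rw [div_le_iff₀ hc] at hrc
    linarith [density_le_one {z : ι → Option α | collapse a z ∈ E}, lt_min hε one_pos])
  rw [Fintype.expect_const] at this
  linarith [min_le_left ε 1]

/-- A function whose average over an intersection of sets, the set of index `a` not distinguishing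
`a` and `none`, is not small has positive average on a subspace inside this intersection. -/
theorem DensityHalesJewett.exists_subspace_of_lt_expect_inter (h : DensityHalesJewett α)
    (s : Finset α) : ∀ (ζ : Type) [Fintype ζ] [DecidableEq ζ] {ε : ℝ}, 0 < ε →
    ∃ (ι : Type) (_ : Fintype ι) (_ : DecidableEq ι),
      ∀ (E : α → Set (ι → α)) (g : (ι → Option α) → ℝ), (∀ z, g z ≤ 1) →
        ε < 𝔼 z, {z | ∀ a ∈ s, collapse a z ∈ E a}.indicator g z →
        ∃ V : Subspace ζ (Option α) ι, (∀ z, ∀ a ∈ s, collapse a (V z) ∈ E a) ∧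
          0 < 𝔼 z, g (V z) := by
  classical
  induction s using Finset.induction_on with
  | empty =>
    intro ζ _ _ ε hε
    refine ⟨ζ, inferInstance, inferInstance, fun E g _ hE =>
      ⟨Subspace.ofEquiv _ (Equiv.refl ζ), by simp, hε.trans (hE.trans_eq ?_)⟩⟩
    simp [Subspace.ofEquiv_apply]
  | insert a s _ ih =>
    intro ζ _ _ ε hε
    obtain ⟨ι', _, _, hι'⟩ := ih ζ (half_pos hε)
    obtain ⟨ι, _, _, hι⟩ := h.exists_subspace_of_lt_expect a ι' (half_pos hε)
    refine ⟨ι, inferInstance, inferInstance, fun E g hg hE => ?_⟩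
    set F := {z : ι → Option α | ∀ b ∈ s, collapse b z ∈ E b} with hF
    obtain ⟨V, hVa, hV⟩ := hι (E a) (fun z => F.indicator g z - ε / 2)
      (fun z => by
        have : F.indicator g z ≤ 1 := Set.indicator_le' (fun z _ => hg z) (by simp) z
        linarith) (by
        have key : ∀ z, {z : ι → Option α | ∀ b ∈ insert a s, collapse b z ∈ E b}.indicator g z
            - ε / 2 ≤ {z | collapse a z ∈ E a}.indicator (fun z => F.indicator g z - ε / 2) z := by
          intro z
          by_cases h1 : collapse a z ∈ E a
          · have : z ∈ {z : ι → Option α | ∀ b ∈ insert a s, collapse b z ∈ E b} ↔ z ∈ F := by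
              simp [hF, h1]
            simp only [Set.indicator_apply, this]
            simp [h1]
          · simp only [Set.indicator_apply]
            simp [h1, (half_pos hε).le]
        have := expect_le_expect fun z (_ : z ∈ univ) => key z
        rw [expect_sub_distrib, Fintype.expect_const] at this
        linarith)
    rw [expect_sub_distrib, Fintype.expect_const] at hV
    obtain ⟨W, hWs, hW⟩ := hι' (fun b => {v | V.map (fun o => o.getD b) v ∈ E b}) (g ∘ V)
      (fun z => hg _) (by
        refine (sub_pos.1 hV).trans_eq (expect_congr rfl fun z _ => ?_)
        simp only [Set.indicator_apply, hF, Set.mem_ofPred_eq, ← Subspace.collapse_apply]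
        rfl)
    refine ⟨V.comp W, fun z b hb => ?_, ?_⟩
    · rw [Subspace.comp_apply]
      obtain rfl | hb := mem_insert.1 hb
      · exact hVa _
      · have := hWs z b hb
        rwa [Set.mem_ofPred_eq, ← Subspace.collapse_apply] at this
    · simpa only [Subspace.comp_apply, comp_apply] using hW

/-- A function of nonpositive average on all `ζ`-dimensional subspaces has small average outside of
any intersection of sets, the set of index `a` not distinguishing `a` and `none`. -/
lemma DensityHalesJewett.exists_expect_indicator_compl_le (h : DensityHalesJewett α)
    (ζ : Type) [Fintype ζ] [DecidableEq ζ] {c : ℝ} (hc : 0 < c) (hc1 : c < 1) :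
    ∃ (ι : Type) (_ : Fintype ι) (_ : DecidableEq ι), Fintype.card ζ ≤ Fintype.card ι ∧
      ∀ (E : α → Set (ι → α)) (g : (ι → Option α) → ℝ), (∀ z, g z ≤ 1) →
        (∀ V : Subspace ζ (Option α) ι, 𝔼 z, g (V z) ≤ 0) →
        𝔼 z, {z | ∀ a, collapse a z ∈ E a}ᶜ.indicator g z ≤ c := by
  classical
  have hpos : (0 : ℝ) < Fintype.card (Finset α) := by exact_mod_cast Fintype.card_pos
  obtain ⟨ι, _, _, hι⟩ := h.exists_subspace_of_lt_expect_inter univ ζ (div_pos hc hpos)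
  have key : ∀ (E : α → Set (ι → α)) (g : (ι → Option α) → ℝ), (∀ z, g z ≤ 1) →
        (∀ V : Subspace ζ (Option α) ι, 𝔼 z, g (V z) ≤ 0) →
        𝔼 z, {z | ∀ a, collapse a z ∈ E a}ᶜ.indicator g z ≤ c := by
    intro E g hg hV
    let cell (t : Finset α) : Set (ι → Option α) :=
      {z | ∀ a ∈ univ, collapse a z ∈ if a ∈ t then (E a)ᶜ else E a}
    have hcell (t : Finset α) (z : ι → Option α) :
        z ∈ cell t ↔ univ.filter (fun a => collapse a z ∉ E a) = t := by
      simp only [cell, Set.mem_ofPred_eq, Finset.ext_iff, mem_filter, mem_univ, true_and,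
        true_imp_iff]
      refine forall_congr' fun a => ?_
      by_cases h1 : a ∈ t <;> simp [h1]
    have hsplit (z : ι → Option α) : {z | ∀ a, collapse a z ∈ E a}ᶜ.indicator g z =
        ∑ t ∈ univ.erase (∅ : Finset α), (cell t).indicator g z := by
      simp only [Set.indicator_apply, hcell]
      rw [sum_ite_eq]
      refine if_congr ?_ rfl rfl
      simp [Finset.ext_iff]
    have hle (t : Finset α) : 𝔼 z, (cell t).indicator g z ≤ c / Fintype.card (Finset α) := by
      by_contra! hcon
      obtain ⟨V, -, hV'⟩ := hι _ g hg hcon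
      exact (hV V).not_gt hV'
    calc 𝔼 z, {z | ∀ a, collapse a z ∈ E a}ᶜ.indicator g z
        = ∑ t ∈ univ.erase (∅ : Finset α), 𝔼 z, (cell t).indicator g z := by
          rw [← expect_sum_comm]
          exact expect_congr rfl fun z _ => hsplit z
      _ ≤ ∑ t ∈ univ.erase (∅ : Finset α), c / Fintype.card (Finset α) :=
          sum_le_sum fun t _ => hle t
      _ ≤ ∑ t : Finset α, c / Fintype.card (Finset α) :=
          sum_le_sum_of_subset_of_nonneg (erase_subset _ _) fun _ _ _ => by positivity
      _ = c := by
          rw [sum_const, card_univ, nsmul_eq_mul, mul_div_cancel₀ _ hpos.ne']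
  refine ⟨ι, inferInstance, inferInstance, ?_, key⟩
  by_contra! hcard
  have := key (fun _ => ∅) (fun _ => 1) (fun _ => le_rfl) fun V => (hcard.not_ge V.card_le).elim
  simp only [Set.mem_empty_iff_false, forall_const] at this
  rw [show {z : ι → Option α | False}ᶜ = Set.univ by ext; simp] at this
  simp only [Set.indicator_univ, Fintype.expect_const] at this
  linarith

/-- For a family of sets of density bounded below, indexed by the words over `α`, there is
a subspace such that many of its lines lie in a positive proportion of the sets. -/
lemma DensityHalesJewett.exists_subspace_le_expect (h : DensityHalesJewett α) {δ : ℝ}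
    (hδ : 0 < δ) : ∃ θ > 0, ∀ (η : Type) [Fintype η] [DecidableEq η],
    ∃ (J : Type) (_ : Fintype J) (_ : DecidableEq J) (ι : Type) (_ : Fintype ι)
      (_ : DecidableEq ι), ∀ (Y : Type) [Fintype Y] [Nonempty Y] (B : (ι → α) → Set Y),
        (∀ w, δ ≤ density (B w)) → ∃ V : Subspace (J ⊕ η) α ι,
          θ ≤ 𝔼 x : J ⊕ η → Option α, density {y | ∀ a, y ∈ B (V (collapse a x))} := by
  obtain ⟨n, hn⟩ := h.exists_line_density_ge hδ
  obtain ⟨θ, hθ, hline⟩ := hn (Fin n) (by simp)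
  refine ⟨θ / Fintype.card (Fin n → Option α), by positivity, fun η _ _ => ?_⟩
  obtain ⟨J, _, _, ι, _, _, hJ, hcol⟩ := exists_subspace_color_eq α n η Prop
  refine ⟨J, inferInstance, inferInstance, ι, inferInstance, inferInstance,
    fun Y _ _ B hB => ?_⟩
  obtain ⟨V, hV⟩ := hcol fun l => θ ≤ density {y | ∀ a, y ∈ B (l a)}
  refine ⟨V, ?_⟩
  have e : Fin n ≃ J := Fintype.equivOfCardEq (by simp [hJ])
  let w₀ : η → α := fun _ => Classical.arbitrary α
  obtain ⟨l, hl⟩ := hline Y (fun u => B (V (Sum.elim (u ∘ e.symm) w₀))) fun u => hB _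
  have hgood (w : η → Option α) : θ ≤ density {y | ∀ a, y ∈ B (V (collapse a
      (Sum.elim (l.idxFun ∘ e.symm) w)))} := by
    obtain ⟨j, hj⟩ := l.proper
    let L (w : η → Option α) : Line α (J ⊕ η) :=
      ⟨Sum.elim (l.idxFun ∘ e.symm) w, Sum.inl (e j), by simp [hj]⟩
    have hLw := hV (L fun i => some (w₀ i)) (L w) (fun _ => rfl) ⟨e j, by simp [L, hj]⟩
    simp only [Subspace.compLine_apply] at hLw
    refine hLw.mp (hl.trans_eq ?_)
    congr! with y a
    ext (i | i) <;> rfl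
  rw [expect_sumElim]
  have hcard : Fintype.card (Fin n → Option α) = Fintype.card (J → Option α) := by simp [hJ]
  rw [hcard, Fintype.expect_eq_sum_div_card]
  gcongr
  refine le_trans ?_ (single_le_sum (fun u _ => expect_nonneg fun w _ => density_nonneg _)
    (mem_univ (l.idxFun ∘ e.symm)))
  exact le_expect univ_nonempty fun w _ => hgood w

end

lemma DensityHalesJewettAt.mono {β : Type} [Fintype β] {δ δ' : ℝ} (h : DensityHalesJewettAt β δ)
    (hδ : δ ≤ δ') : DensityHalesJewettAt β δ' := by
  obtain ⟨n, hn⟩ := h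
  exact ⟨n, fun ι _ _ hι A hA => hn ι hι A (hδ.trans hA)⟩

/-- If the density Hales-Jewett property fails, there is a threshold density for it. -/
lemma exists_critical_density {β : Type} [Fintype β] (h : ¬ DensityHalesJewett β) :
    ∃ δ > 0, ∀ ε > 0, DensityHalesJewettAt β (δ + ε) ∧ ¬ DensityHalesJewettAt β (δ - ε) := by
  unfold DensityHalesJewett at h
  push Not at h
  obtain ⟨δ₀, hδ₀, h₀⟩ := h
  have hbdd : BddAbove {δ | ¬ DensityHalesJewettAt β δ} := ⟨1, fun δ hδ => by
    by_contra! hlt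
    exact hδ ⟨0, fun ι _ _ _ A hA => absurd (hlt.trans_le hA) (density_le_one A).not_gt⟩⟩
  refine ⟨sSup {δ | ¬ DensityHalesJewettAt β δ}, hδ₀.trans_le (le_csSup hbdd h₀),
    fun ε hε => ⟨?_, fun hcon => ?_⟩⟩
  · by_contra hcon
    linarith [le_csSup hbdd hcon]
  · obtain ⟨s, hs, hlt⟩ := exists_lt_of_lt_csSup (s := {δ | ¬ DensityHalesJewettAt β δ})
      ⟨δ₀, h₀⟩ (sub_lt_self _ hε)
    exact hs (hcon.mono hlt.le)

/-- If all values are at most slightly above the average, they are at least slightly below it. -/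
lemma sub_le_of_forall_le {X : Type*} [Fintype X] {d : X → ℝ} {δ γ : ℝ} (hγ : 0 ≤ γ)
    (hd : ∀ x, d x ≤ δ + γ) (h : δ - γ ≤ 𝔼 x, d x) (x : X) :
    δ - 2 * Fintype.card X * γ ≤ d x := by
  classical
  have : Nonempty X := ⟨x⟩
  have hpos : (0 : ℝ) < Fintype.card X := by exact_mod_cast Fintype.card_pos
  rw [Fintype.expect_eq_sum_div_card, le_div_iff₀ hpos, ← add_sum_erase _ _ (mem_univ x)] at h
  have h1 : ∑ y ∈ univ.erase x, d y ≤ ∑ y ∈ univ.erase x, (δ + γ) := sum_le_sum fun y _ => hd y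
  rw [sum_const, card_erase_of_mem (mem_univ x), nsmul_eq_mul, card_univ,
    Nat.cast_pred Fintype.card_pos] at h1
  nlinarith

lemma density_forall_isSome {α ι : Type} [Fintype α] [Fintype ι] [DecidableEq ι] :
    density {z : ι → Option α | ∀ i, (z i).isSome} =
      (Fintype.card α / (Fintype.card α + 1) : ℝ) ^ Fintype.card ι := by
  classical
  have := density_pi (fun _ : ι => (univ : Finset (Option α)).erase none)
  simp only [mem_erase, mem_univ, and_true, card_erase_of_mem, card_univ, prod_const,
    Fintype.card_option, Nat.add_sub_cancel, Nat.cast_add, Nat.cast_one] at this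
  rw [← this]
  congr! with z i
  exact Option.isSome_iff_ne_none

/-- In a set without combinatorial lines, a word containing the letter `none` is not in the set if
all words obtained by replacing `none` by another letter are. -/
lemma forall_isSome_of_forall_collapse_mem {α : Type} {ι : Type*} {A : Set (ι → Option α)}
    (hA : ∀ l : Line (Option α) ι, ¬ ∀ a, l a ∈ A) {x : ι → Option α} (hx : x ∈ A)
    (hc : ∀ a, some ∘ collapse a x ∈ A) (i : ι) : (x i).isSome := by
  by_contra hi
  let l : Line α ι := ⟨x, i, by simpa using hi⟩
  refine hA (l.map some) fun o => ?_
  cases o with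
  | none =>
    convert hx using 1
    ext1 j
    simp only [Line.map, Line.coe_apply, l]
    cases x j <;> rfl
  | some a =>
    rw [Line.map_apply]
    exact hc a

/-- The induction step in the proof of the density Hales-Jewett theorem. -/
theorem DensityHalesJewett.option {α : Type} [Fintype α] [Nonempty α]
    (h : DensityHalesJewett α) : DensityHalesJewett (Option α) := by
  by_contra hcon
  obtain ⟨δ, hδ, hcrit⟩ := exists_critical_density hcon
  obtain ⟨θ, hθ, hV⟩ := h.exists_subspace_le_expect (half_pos hδ)
  obtain ⟨c, hc, hc1, hc2, hc3⟩ : ∃ c > 0, c < 1 ∧ c ≤ δ / 2 ∧ 4 * c < δ * θ := by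
    refine ⟨min (1 / 2) (min (δ / 2) (δ * θ / 5)), by positivity, ?_, ?_, ?_⟩
    · exact (min_le_left _ _).trans_lt (by norm_num)
    · exact (min_le_right _ _).trans (min_le_left _ _)
    · have : min (1 / 2) (min (δ / 2) (δ * θ / 5)) ≤ δ * θ / 5 :=
        (min_le_right _ _).trans (min_le_right _ _)
      nlinarith [mul_pos hδ hθ]
  obtain ⟨m, hm⟩ : ∃ m : ℕ, (Fintype.card α / (Fintype.card α + 1) : ℝ) ^ m < c :=
    exists_pow_lt_of_lt_one hc (by rw [div_lt_one (by positivity)]; linarith)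
  obtain ⟨N, hN⟩ := (hcrit c hc).1
  obtain ⟨η, _, _, hη, hcompl⟩ := h.exists_expect_indicator_compl_le (Fin (max N m)) hc hc1
  obtain ⟨J, _, _, ι, _, _, hJ⟩ := hV η
  have hpos : (0 : ℝ) < Fintype.card (ι → Option α) := by exact_mod_cast Fintype.card_pos
  set γ : ℝ := c / (2 * Fintype.card (ι → Option α)) with hγ
  have hγ0 : 0 < γ := by positivity
  obtain ⟨N', hN'⟩ := (hcrit γ hγ0).1
  -- a set without lines of almost maximal density, in a product of two cubes
  obtain ⟨n, A, hA, hfree, hnN⟩ : ∃ (n : ℕ) (A : Set (ι ⊕ Fin n → Option α)),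
      δ - γ ≤ density A ∧ (∀ l : Line (Option α) (ι ⊕ Fin n), ¬ ∀ a, l a ∈ A) ∧ N' ≤ n := by
    have := (hcrit γ hγ0).2
    unfold DensityHalesJewettAt at this
    push Not at this
    obtain ⟨I, _, _, hI, A, hA, hline⟩ := this (Fintype.card ι + N')
    obtain ⟨n, hn, ⟨e⟩⟩ := exists_sum_equiv hI
    refine ⟨n, Subspace.ofEquiv _ e ⁻¹' A, by rwa [density_ofEquiv_preimage], fun l hl => ?_, hn⟩
    obtain ⟨a, ha⟩ := hline ((Subspace.ofEquiv _ e).compLine l)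
    exact ha (by rw [Subspace.compLine_apply]; exact hl a)
  have hsub {κ : Type} (V : Subspace κ (Option α) (ι ⊕ Fin n)) (l : Line (Option α) κ) :
      ¬ ∀ a, l a ∈ V ⁻¹' A := fun hl =>
    hfree (V.compLine l) fun a => by rw [Subspace.compLine_apply]; exact hl a
  have hsec (x : ι → Option α) : δ - c ≤ density {y : Fin n → Option α | Sum.elim x y ∈ A} := by
    rw [density_eq_expect_sumElim] at hA
    have := sub_le_of_forall_le hγ0.le (fun x => ?_) hA x
    · rwa [show 2 * (Fintype.card (ι → Option α) : ℝ) * γ = c by rw [hγ]; field_simp] at this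
    · by_contra! hlt
      obtain ⟨l, hl⟩ := hN' (Fin n) (by simpa using hnN) _ hlt.le
      refine hsub (Subspace.vertical x (Subspace.ofEquiv _ (Equiv.refl _))) l fun a => ?_
      rw [Set.mem_preimage, Subspace.vertical_apply]
      exact hl a
  obtain ⟨V, hVθ⟩ := hJ (Fin n → Option α) (fun w => {y | Sum.elim (some ∘ w) y ∈ A})
    fun w => (by linarith : δ / 2 ≤ δ - c).trans (hsec _)
  set B : (Fin n → Option α) → Set (J ⊕ η → Option α) := fun y =>
    (V.map some).horizontal y ⁻¹' A with hB
  set D : (Fin n → Option α) → Set (J ⊕ η → Option α) := fun y =>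
    {x | ∀ a, some ∘ collapse a x ∈ B y} with hD
  have hmemB (y) (x) : x ∈ B y ↔ Sum.elim (V.map some x) y ∈ A := by
    rw [hB, Set.mem_preimage, Subspace.horizontal_apply]
  have hBdens : δ - c ≤ 𝔼 y, density (B y) := by
    simp only [density]
    rw [expect_comm]
    refine le_expect univ_nonempty fun x _ => (hsec (V.map some x)).trans_eq ?_
    refine expect_congr rfl fun y _ => ?_
    classical
    simp only [Set.indicator_apply, hmemB]
    rfl
  have hDdens : θ ≤ 𝔼 y, density (D y) := by
    refine hVθ.trans_eq ?_
    simp only [density]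
    rw [expect_comm]
    refine expect_congr rfl fun y _ => expect_congr rfl fun x _ => ?_
    classical
    simp only [Set.indicator_apply, hD, Set.mem_ofPred_eq, hmemB, Subspace.map_comp_apply,
      Pi.one_apply]
  have hout (y) : 𝔼 x, (D y)ᶜ.indicator (fun x => (B y).indicator 1 x - (δ + c)) x ≤ c := by
    rw [expect_sumElim]
    refine expect_le univ_nonempty fun u _ => ?_
    refine le_trans (le_of_eq ?_) (hcompl
      (fun a => {v | some ∘ Sum.elim (collapse a u) v ∈ B y})
      (fun w => (B y).indicator 1 (Sum.elim u w) - (δ + c)) (fun w => ?_) fun W => ?_)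
    · refine expect_congr rfl fun w _ => ?_
      classical
      simp only [Set.indicator_apply, hD, Set.mem_compl_iff, Set.mem_ofPred_eq, collapse_sumElim]
    · have : (B y).indicator (1 : (J ⊕ η → Option α) → ℝ) (Sum.elim u w) ≤ 1 :=
        Set.indicator_le_self' (by simp) _
      linarith
    · rw [expect_sub_distrib, Fintype.expect_const, sub_nonpos]
      by_contra! hlt
      obtain ⟨l, hl⟩ := hN (Fin (max N m)) (by simp)
        {z | Sum.elim u (W z) ∈ B y} hlt.le
      refine hsub (((V.map some).horizontal y).comp (Subspace.vertical u W)) l fun a => ?_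
      rw [Set.mem_preimage, Subspace.comp_apply, Subspace.vertical_apply]
      exact hl a
  have hin (y) : 𝔼 x, (D y).indicator ((B y).indicator 1) x ≤ c := by
    have hle : 𝔼 x, (D y).indicator ((B y).indicator 1) x ≤
        density {x : J ⊕ η → Option α | ∀ i, (x i).isSome} := by
      refine expect_le_expect fun x _ => ?_
      by_cases h1 : x ∈ D y ∧ x ∈ B y
      · have := forall_isSome_of_forall_collapse_mem (hsub ((V.map some).horizontal y)) h1.2 h1.1
        rw [Set.indicator_of_mem h1.1, Set.indicator_of_mem h1.2,
          Set.indicator_of_mem (by exact this)]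
      · rw [Set.indicator_indicator, Set.indicator_of_notMem (by exact h1)]
        exact Set.indicator_nonneg (by simp) _
    refine hle.trans (le_trans ?_ hm.le)
    rw [density_forall_isSome]
    refine pow_le_pow_of_le_one (by positivity) ?_ ?_
    · rw [div_le_one (by positivity)]
      linarith
    · rw [Fintype.card_fin] at hη
      rw [Fintype.card_sum]
      exact ((le_max_right N m).trans hη).trans (Nat.le_add_left _ _)
  have htotal (y) : density (B y) ≤ c + c + (δ + c) * (1 - density (D y)) := by
    have hsplit : density (B y) = (𝔼 x, (D y).indicator ((B y).indicator 1) x) +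
        (𝔼 x, (D y)ᶜ.indicator (fun x => (B y).indicator 1 x - (δ + c)) x) +
        (δ + c) * density (D y)ᶜ := by
      rw [density, density, mul_expect, ← expect_add_distrib, ← expect_add_distrib]
      refine expect_congr rfl fun x _ => ?_
      by_cases hx : x ∈ D y <;> simp [hx]
    have := density_add_density_compl (D y)
    rw [hsplit, ← this, add_sub_cancel_left]
    linarith [hin y, hout y]
  have hfinal := expect_le_expect fun y (_ : y ∈ univ) => htotal y
  rw [expect_add_distrib, Fintype.expect_const, ← mul_expect, expect_sub_distrib,
    Fintype.expect_const] at hfinal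
  have h0 : 0 ≤ 𝔼 y, density (D y) := hθ.le.trans hDdens
  nlinarith [mul_le_mul_of_nonneg_left hDdens hδ.le, mul_nonneg hc.le h0]

lemma densityHalesJewett_of_subsingleton (α : Type) [Fintype α] [Subsingleton α] [Nonempty α] :
    DensityHalesJewett α := by
  intro δ hδ
  refine ⟨1, fun ι _ _ hι A hA => ?_⟩
  obtain ⟨x, hx⟩ := nonempty_of_density_pos (hδ.trans_le hA)
  obtain ⟨i⟩ : Nonempty ι := Fintype.card_pos_iff.1 hι
  refine ⟨⟨fun _ => none, i, rfl⟩, fun a => ?_⟩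
  convert hx using 1

/-- The density Hales-Jewett theorem: there are alphabets of any size for which every dense subset
of a cube of large dimension contains a combinatorial line. -/
theorem exists_densityHalesJewett (k : ℕ) :
    ∃ (α : Type) (_ : Fintype α) (_ : Nonempty α), Fintype.card α = k + 1 ∧
      DensityHalesJewett α := by
  induction k with
  | zero =>
    exact ⟨Unit, inferInstance, inferInstance, rfl, densityHalesJewett_of_subsingleton Unit⟩
  | succ k ih =>
    obtain ⟨α, _, _, hα, h⟩ := ih
    exact ⟨Option α, inferInstance, inferInstance, by simp [hα], h.option⟩

end Combinatorics

open Combinatorics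

/-- Multiple recurrence in measure preserving systems, with uniform bounds. -/
theorem exists_le_measureReal_iInter_preimage_iterate (k : ℕ) {δ : ℝ} (hδ : 0 < δ) :
    ∃ θ > 0, ∃ n : ℕ, ∀ (X : Type) [MeasurableSpace X] (μ : Measure X) [IsProbabilityMeasure μ]
      (T : X → X), MeasurePreserving T μ μ → ∀ A : Set X, MeasurableSet A → δ ≤ μ.real A →
        ∀ d : ℕ, ∃ r ∈ Finset.Icc 1 n,
          θ ≤ μ.real (⋂ i ∈ Finset.range (k + 1), T^[i * (d * r)] ⁻¹' A) := by
  classical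
  obtain ⟨α, _, _, hα, h⟩ := exists_densityHalesJewett k
  obtain ⟨n, hn⟩ := h (δ / 2) (half_pos hδ)
  let e : α ≃ Fin (k + 1) := Fintype.equivOfCardEq (by simp [hα])
  refine ⟨δ / 2 / (Nat.card (Line α (Fin n)) + 1), by positivity, n,
    fun X _ μ _ T hT A hA hδA d => ?_⟩
  let B (w : Fin n → α) : Set X := T^[d * ∑ i, (e (w i) : ℕ)] ⁻¹' A
  have hBm (w) : MeasurableSet (B w) := (hT.iterate _).measurable hA
  have hBμ (w) : μ.real (B w) = μ.real A := (hT.iterate _).measureReal_preimage hA.nullMeasurableSet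
  let L (l : Line α (Fin n)) : Set X := ⋂ a, B (l a)
  have hLm (l) : MeasurableSet (L l) := MeasurableSet.iInter fun a => hBm _
  have := Fintype.ofFinite (Line α (Fin n))
  have hUm : MeasurableSet (⋃ l, L l) := MeasurableSet.iUnion hLm
  have hpt (x : X) : 𝔼 w, (B w).indicator (1 : X → ℝ) x ≤
      (⋃ l, L l).indicator (1 : X → ℝ) x + δ / 2 := by
    have hdens : 𝔼 w, (B w).indicator (1 : X → ℝ) x = density {w | x ∈ B w} :=
      expect_congr rfl fun w _ => by simp [Set.indicator_apply]
    rw [hdens]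
    by_cases hx : x ∈ ⋃ l, L l
    · rw [Set.indicator_of_mem hx, Pi.one_apply]
      linarith [density_le_one {w | x ∈ B w}]
    · rw [Set.indicator_of_notMem hx, zero_add]
      by_contra! hlt
      obtain ⟨l, hl⟩ := hn (Fin n) (by simp) _ hlt.le
      exact hx (Set.mem_iUnion.2 ⟨l, Set.mem_iInter.2 hl⟩)
  have hintegral (s : Set X) (hs : MeasurableSet s) : Integrable (s.indicator (1 : X → ℝ)) μ :=
    (integrable_const (1 : ℝ)).indicator hs
  have hU : δ / 2 ≤ μ.real (⋃ l, L l) := by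
    have := integral_mono (μ := μ)
      (by
        simp only [Fintype.expect_eq_sum_div_card]
        exact (integrable_finsetSum _ fun w _ => hintegral _ (hBm w)).div_const _)
      ((hintegral _ hUm).add (integrable_const _)) hpt
    simp only [Pi.add_apply] at this
    rw [integral_add (hintegral _ hUm) (integrable_const _), integral_indicator_one hUm] at this
    simp only [Fintype.expect_eq_sum_div_card] at this
    rw [integral_div, integral_finsetSum _ fun w _ => hintegral _ (hBm w)] at this
    simp only [integral_indicator_one (hBm _), hBμ] at this
    rw [← Fintype.expect_eq_sum_div_card, Fintype.expect_const] at this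
    simp only [integral_const, probReal_univ, one_smul] at this
    linarith
  obtain ⟨l, hl⟩ : ∃ l, δ / 2 / (Nat.card (Line α (Fin n)) + 1) ≤ μ.real (L l) := by
    by_contra! hcon
    have h1 := hU.trans (measureReal_iUnion_fintype_le (μ := μ) L)
    have h2 : ∑ l, μ.real (L l) ≤ ∑ _l : Line α (Fin n), δ / 2 / (Nat.card (Line α (Fin n)) + 1) :=
      sum_le_sum fun l _ => (hcon l).le
    rw [sum_const, card_univ, nsmul_eq_mul, Nat.card_eq_fintype_card] at h2
    have h3 : (Fintype.card (Line α (Fin n)) : ℝ) * (δ / 2 / (Fintype.card (Line α (Fin n)) + 1))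
        < δ / 2 := by
      rw [← mul_div_assoc, div_lt_iff₀ (by positivity)]
      linarith
    linarith
  let r := #{i | l.idxFun i = none}
  let C := ∑ i, ((l.idxFun i).map fun a => (e a : ℕ)).getD 0
  have hsum (a : α) : ∑ i, (e (l a i) : ℕ) = C + r * e a := by
    have : ∀ i, (e (l a i) : ℕ) = ((l.idxFun i).map fun a => (e a : ℕ)).getD 0 +
        if l.idxFun i = none then (e a : ℕ) else 0 := by
      intro i
      cases hi : l.idxFun i <;> simp [Line.coe_apply, hi]
    rw [sum_congr rfl fun i _ => this i, sum_add_distrib, ← sum_filter, sum_const, smul_eq_mul]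
  refine ⟨r, mem_Icc.2 ⟨?_, ?_⟩, hl.trans_eq ?_⟩
  · obtain ⟨i, hi⟩ := l.proper
    exact card_pos.2 ⟨i, by simp [hi]⟩
  · exact (card_le_univ _).trans_eq (by simp)
  · rw [← (hT.iterate (d * C)).measureReal_preimage (MeasurableSet.nullMeasurableSet
      (Finset.measurableSet_biInter _ fun i _ => (hT.iterate _).measurable hA))]
    congr 1
    ext x
    simp only [L, B, Set.mem_iInter, Set.mem_preimage, hsum, mem_range, ← iterate_add_apply]
    have hexp (a : α) : d * (C + r * e a) = e a * (d * r) + d * C := by ring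
    simp only [hexp]
    refine ⟨fun hx i hi => ?_, fun hx a => hx _ (e a).2⟩
    simpa using hx (e.symm ⟨i, hi⟩)

end

section

open Function Finset Filter Topology Polynomial

lemma norm_sum_range_sub_sum_range_shift_le {E : Type*} [NormedAddCommGroup E] {u : ℕ → E}
    (hu : ∀ n, ‖u n‖ ≤ 1) (N h : ℕ) :
    ‖∑ n ∈ range N, u n - ∑ n ∈ range N, u (n + h)‖ ≤ 2 * h := by
  have hsum : ∑ n ∈ range N, u n - ∑ n ∈ range N, u (n + h) =
      ∑ n ∈ range h, u n - ∑ n ∈ range h, u (N + n) := by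
    rw [sub_eq_sub_iff_add_eq_add, ← sum_range_add u N h, add_comm N h, sum_range_add u h N]
    simp only [add_comm h]
  rw [hsum]
  refine (norm_sub_le _ _).trans ?_
  have hle (v : ℕ → E) (hv : ∀ n, ‖v n‖ ≤ 1) : ‖∑ n ∈ range h, v n‖ ≤ h :=
    (norm_sum_le_of_le _ fun n _ => hv n).trans_eq (by simp)
  linarith [hle u hu, hle (fun n => u (N + n)) fun n => hu _]

section vanDerCorput

variable {E : Type*} [NormedAddCommGroup E] [InnerProductSpace ℂ E]

/-- **van der Corput's inequality** in an inner product space. -/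
lemma norm_sum_range_div_le {u : ℕ → E} (hu : ∀ n, ‖u n‖ ≤ 1) {N H : ℕ} (hN : 0 < N)
    (hH : 0 < H) :
    ‖∑ n ∈ range N, u n‖ / N ≤
      √(H + ∑ p ∈ (range H ×ˢ range H).filter fun p => p.1 ≠ p.2,
        ‖(∑ n ∈ range N, inner ℂ (u (n + p.1)) (u (n + p.2))) / N‖) / H + 2 * H / N := by
  set G := ∑ p ∈ (range H ×ˢ range H).filter fun p => p.1 ≠ p.2,
        ‖(∑ n ∈ range N, inner ℂ (u (n + p.1)) (u (n + p.2))) / (N : ℂ)‖ with hG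
  have hN' : (0 : ℝ) < N := by exact_mod_cast hN
  have hH' : (0 : ℝ) < H := by exact_mod_cast hH
  have hshift : ‖(H : ℂ) • ∑ n ∈ range N, u n - ∑ n ∈ range N, ∑ h ∈ range H, u (n + h)‖ ≤
      2 * H * H := by
    rw [sum_comm]
    have : (H : ℂ) • ∑ n ∈ range N, u n = ∑ _h ∈ range H, ∑ n ∈ range N, u n := by
      rw [sum_const, card_range, Nat.cast_smul_eq_nsmul]
    rw [this, ← sum_sub_distrib]
    refine (norm_sum_le_of_le (n := fun _ => 2 * (H : ℝ)) _ fun h hh =>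
      (norm_sum_range_sub_sum_range_shift_le hu N h).trans ?_).trans_eq ?_
    · have : (h : ℝ) ≤ H := by exact_mod_cast (mem_range.1 hh).le
      linarith
    · rw [sum_const, card_range, nsmul_eq_mul]
      ring
  have hsq : ∑ n ∈ range N, ‖∑ h ∈ range H, u (n + h)‖ ^ 2 ≤ N * (H + G) := by
    have hexp : ((∑ n ∈ range N, ‖∑ h ∈ range H, u (n + h)‖ ^ 2 : ℝ) : ℂ) =
        ∑ p ∈ range H ×ˢ range H, ∑ n ∈ range N, inner ℂ (u (n + p.1)) (u (n + p.2)) := by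
      rw [sum_comm]
      push_cast
      refine sum_congr rfl fun n _ => ?_
      refine (inner_self_eq_norm_sq_to_K (𝕜 := ℂ) (∑ h ∈ range H, u (n + h))).symm.trans ?_
      rw [sum_inner, sum_product]
      simp only [inner_sum]
    have hterm (p : ℕ × ℕ) : ‖∑ n ∈ range N, inner ℂ (u (n + p.1)) (u (n + p.2))‖ ≤ N := by
      refine (norm_sum_le_of_le (n := fun _ => (1 : ℝ)) _ fun n _ => ?_).trans_eq (by simp)
      exact (norm_inner_le_norm _ _).trans (mul_le_one₀ (hu _) (norm_nonneg _) (hu _))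
    calc ∑ n ∈ range N, ‖∑ h ∈ range H, u (n + h)‖ ^ 2
        = ‖((∑ n ∈ range N, ‖∑ h ∈ range H, u (n + h)‖ ^ 2 : ℝ) : ℂ)‖ := by
          rw [Complex.norm_real, Real.norm_of_nonneg (by positivity)]
      _ ≤ ∑ p ∈ range H ×ˢ range H, ‖∑ n ∈ range N, inner ℂ (u (n + p.1)) (u (n + p.2))‖ := by
          rw [hexp]
          exact norm_sum_le _ _
      _ = (∑ p ∈ (range H ×ˢ range H).filter fun p => p.1 = p.2,
            ‖∑ n ∈ range N, inner ℂ (u (n + p.1)) (u (n + p.2))‖) +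
          ∑ p ∈ (range H ×ˢ range H).filter fun p => p.1 ≠ p.2,
            ‖∑ n ∈ range N, inner ℂ (u (n + p.1)) (u (n + p.2))‖ :=
          (sum_filter_add_sum_filter_not _ _ _).symm
      _ ≤ N * H + N * G := by
          refine add_le_add ?_ (le_of_eq ?_)
          · refine (sum_le_sum fun p _ => hterm p).trans_eq ?_
            rw [sum_const, ← diag_eq_filter, diag_card, card_range, nsmul_eq_mul, mul_comm]
          · rw [hG, mul_sum]
            refine sum_congr rfl fun p _ => ?_
            rw [norm_div, Complex.norm_natCast, mul_div_cancel₀ _ hN'.ne']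
      _ = N * (H + G) := by ring
  have hcs : ‖∑ n ∈ range N, ∑ h ∈ range H, u (n + h)‖ ≤ N * √(H + G) := by
    have h1 : ‖∑ n ∈ range N, ∑ h ∈ range H, u (n + h)‖ ≤
        ∑ n ∈ range N, ‖∑ h ∈ range H, u (n + h)‖ := norm_sum_le _ _
    have h2 := sq_sum_le_card_mul_sum_sq (s := range N)
      (f := fun n => ‖∑ h ∈ range H, u (n + h)‖)
    rw [card_range] at h2
    have h3 : (∑ n ∈ range N, ‖∑ h ∈ range H, u (n + h)‖) ^ 2 ≤ N ^ 2 * (H + G) := by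
      refine h2.trans ?_
      rw [sq, mul_assoc]
      gcongr
    refine h1.trans ?_
    have h4 := Real.le_sqrt_of_sq_le h3
    rwa [Real.sqrt_mul (by positivity), Real.sqrt_sq hN'.le] at h4
  have hmain : H * ‖∑ n ∈ range N, u n‖ ≤ N * √(H + G) + 2 * H * H := by
    have := norm_sub_norm_le ((H : ℂ) • ∑ n ∈ range N, u n)
      (∑ n ∈ range N, ∑ h ∈ range H, u (n + h))
    rw [norm_smul, Complex.norm_natCast] at this
    linarith
  rw [div_add_div _ _ hH'.ne' hN'.ne', div_le_div_iff₀ hN' (by positivity)]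
  nlinarith

/-- If the correlations of a bounded sequence tend to zero in the mean, so does the sequence. -/
lemma tendsto_norm_sum_range_div_of_inner {u : ℕ → E} (hu : ∀ n, ‖u n‖ ≤ 1)
    (hc : ∀ h h' : ℕ, h ≠ h' → Tendsto (fun N : ℕ =>
      (∑ n ∈ range N, inner ℂ (u (n + h)) (u (n + h'))) / (N : ℂ)) atTop (𝓝 0)) :
    Tendsto (fun N : ℕ => ‖∑ n ∈ range N, u n‖ / N) atTop (𝓝 0) := by
  rw [Metric.tendsto_atTop']
  intro ε hε
  obtain ⟨H, hH⟩ := exists_nat_gt (1 / ε ^ 2)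
  have hH' : (0 : ℝ) < H := lt_trans (by positivity) hH
  have hlim : Tendsto (fun N : ℕ => √(H + ∑ p ∈ (range H ×ˢ range H).filter fun p => p.1 ≠ p.2,
        ‖(∑ n ∈ range N, inner ℂ (u (n + p.1)) (u (n + p.2))) / (N : ℂ)‖) / H + 2 * H / N) atTop
      (𝓝 (√(H + ∑ _p ∈ (range H ×ˢ range H).filter fun p => p.1 ≠ p.2, (0 : ℝ)) / H + 0)) := by
    refine Tendsto.add (Tendsto.div_const (Tendsto.sqrt (tendsto_const_nhds.add
      (tendsto_finsetSum _ fun p hp => ?_))) _) (tendsto_const_div_atTop_nhds_zero_nat _)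
    simpa using (hc p.1 p.2 (mem_filter.1 hp).2).norm
  have hlt : √(H + ∑ _p ∈ (range H ×ˢ range H).filter fun p => p.1 ≠ p.2, (0 : ℝ)) / H + 0
      < ε := by
    rw [sum_const_zero, add_zero, add_zero, Real.sqrt_div_self, ← one_div,
      div_lt_iff₀ (Real.sqrt_pos.2 hH'), ← div_lt_iff₀' hε]
    exact Real.lt_sqrt_of_sq_lt (by rwa [div_pow, one_pow])
  obtain ⟨N₀, hN₀⟩ := eventually_atTop.1 (hlim.eventually_lt_const hlt)
  refine ⟨N₀ , fun N hN => ?_⟩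
  rw [dist_zero_right, Real.norm_of_nonneg (by positivity)]
  exact (norm_sum_range_div_le hu ((Nat.zero_le _).trans_lt hN) (by exact_mod_cast hH')).trans_lt
    (hN₀ N hN.le)

end vanDerCorput

lemma coeff_taylor_sub_taylor {p : ℝ[X]} {j : ℕ} (hp : p.natDegree ≤ j + 1) (r s : ℝ) :
    (taylor r p - taylor s p).coeff j = (j + 1) * p.coeff (j + 1) * (r - s) := by
  have hd : (hasseDeriv j p).natDegree ≤ 1 := (natDegree_hasseDeriv_le p j).trans (by omega)
  rw [coeff_sub, taylor_coeff, taylor_coeff, eq_X_add_C_of_natDegree_le_one hd]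
  simp only [eval_add, eval_mul, eval_C, eval_X, hasseDeriv_coeff, add_comm 1 j,
    Nat.choose_succ_self_right]
  push_cast
  ring

lemma natDegree_taylor_sub_taylor_le {p : ℝ[X]} {j : ℕ} (hp : p.natDegree ≤ j + 1) (r s : ℝ) :
    (taylor r p - taylor s p).natDegree ≤ j := by
  rw [natDegree_le_iff_coeff_eq_zero]
  intro m hm
  obtain rfl | hlt := (Nat.succ_le_of_lt hm).eq_or_lt
  · have hd : (hasseDeriv (j + 1) p).natDegree ≤ 0 :=
      (natDegree_hasseDeriv_le p (j + 1)).trans (by omega)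
    rw [Nat.succ_eq_add_one, coeff_sub, taylor_coeff, taylor_coeff, eq_C_of_natDegree_le_zero hd]
    simp
  · refine coeff_eq_zero_of_natDegree_lt (((natDegree_sub_le _ _).trans ?_).trans_lt hlt)
    rw [natDegree_taylor, natDegree_taylor, max_self]
    exact hp

lemma tendsto_sum_fourierChar_linear_div {a : ℝ} (ha : Irrational a) (b : ℝ) :
    Tendsto (fun N : ℕ => (∑ n ∈ range N, (Real.fourierChar (a * n + b) : ℂ)) / N) atTop
      (𝓝 0) := by
  have hz : (Real.fourierChar a : ℂ) ≠ 1 := by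
    intro h
    rw [Real.fourierChar_apply, Complex.exp_eq_one_iff] at h
    obtain ⟨m, hm⟩ := h
    have hm' : (a : ℂ) = m := by
      have h2 : (2 * Real.pi * Complex.I : ℂ) ≠ 0 := Complex.two_pi_I_ne_zero
      apply mul_right_cancel₀ h2
      rw [← hm]
      push_cast
      ring
    exact ha ⟨m, by exact_mod_cast hm'.symm⟩
  have hsum (N : ℕ) : ∑ n ∈ range N, (Real.fourierChar (a * n + b) : ℂ) =
      ((Real.fourierChar a : ℂ) ^ N - 1) / ((Real.fourierChar a : ℂ) - 1) *
        Real.fourierChar b := by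
    rw [← geom_sum_eq hz, sum_mul]
    refine sum_congr rfl fun n _ => ?_
    rw [AddChar.map_add_eq_mul, mul_comm a, ← nsmul_eq_mul, AddChar.map_nsmul_eq_pow]
    push_cast
    rfl
  refine squeeze_zero_norm (a := fun N : ℕ => 2 / ‖(Real.fourierChar a : ℂ) - 1‖ / N)
    (fun N => ?_) (tendsto_const_div_atTop_nhds_zero_nat _)
  rw [hsum, norm_div, norm_mul, norm_div, Circle.norm_coe, mul_one, Complex.norm_natCast]
  gcongr
  refine (norm_sub_le _ _).trans_eq ?_
  rw [norm_pow, Circle.norm_coe, norm_one]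
  norm_num

/-- Multiple correlations of length `j + 1` do not correlate with polynomial phases of degree
`j + 1` with irrational leading coefficient. -/
theorem tendsto_sum_fourierChar_mul_integral_div {X : Type*} [MeasurableSpace X] {μ : Measure X}
    [IsProbabilityMeasure μ] {T : X → X} (hT : MeasurePreserving T μ μ) (j : ℕ) :
    ∀ (p : ℝ[X]), p.natDegree ≤ j + 1 → Irrational (p.coeff (j + 1)) →
    ∀ f : ℕ → X → ℂ, (∀ i, Measurable (f i)) → (∀ i x, ‖f i x‖ ≤ 1) →
      Tendsto (fun N : ℕ => (∑ n ∈ range N, (Real.fourierChar (p.eval (n : ℝ)) : ℂ) *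
        ∫ x, ∏ i ∈ range (j + 1), f i (T^[i * n] x) ∂μ) / N) atTop (𝓝 0) := by
  induction j with
  | zero =>
    intro p hp hirr f _ _
    have := (tendsto_sum_fourierChar_linear_div hirr (p.coeff 0)).mul_const (∫ x, f 0 x ∂μ)
    rw [zero_mul] at this
    refine this.congr fun N => ?_
    rw [div_mul_eq_mul_div, sum_mul]
    congr 1
    refine sum_congr rfl fun n _ => ?_
    have hev : p.eval (n : ℝ) = p.coeff (0 + 1) * n + p.coeff 0 := by
      conv_lhs => rw [eq_X_add_C_of_natDegree_le_one hp]
      simp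
    simp [hev]
  | succ j ih =>
    intro p hp hirr f hf hf1
    let u (n : ℕ) (x : X) : ℂ := (Real.fourierChar (p.eval (n : ℝ)) : ℂ) *
      ∏ i ∈ range (j + 1), f (i + 1) (T^[(i + 1) * n] x)
    have hprod1 (n : ℕ) (x : X) : ‖∏ i ∈ range (j + 1), f (i + 1) (T^[(i + 1) * n] x)‖ ≤ 1 := by
      rw [norm_prod]
      exact prod_le_one (fun _ _ => norm_nonneg _) fun _ _ => hf1 _ _
    have hum (n : ℕ) : Measurable (u n) := measurable_const.mul
      (Finset.measurable_fun_prod _ fun i _ => (hf _).comp (hT.iterate _).measurable)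
    have hu1 (n : ℕ) (x : X) : ‖u n x‖ ≤ 1 := by
      rw [norm_mul, Circle.norm_coe, one_mul]
      exact hprod1 n x
    have hmem {g : X → ℂ} (hg : Measurable g) (hg1 : ∀ x, ‖g x‖ ≤ 1) : MemLp g 2 μ :=
      MemLp.of_bound hg.aestronglyMeasurable 1 (ae_of_all _ hg1)
    have hnorm {g : X → ℂ} (hg : Measurable g) (hg1 : ∀ x, ‖g x‖ ≤ 1) :
        ‖(hmem hg hg1).toLp g‖ ≤ 1 := by
      have hae : ∀ᵐ x ∂μ, ‖(hmem hg hg1).toLp g x‖ ≤ 1 := by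
        filter_upwards [(hmem hg hg1).coeFn_toLp] with x hx
        rw [hx]
        exact hg1 x
      simpa [measureUnivNNReal] using Lp.norm_le_of_ae_bound zero_le_one hae
    have hinner {g g' : X → ℂ} (hg : Measurable g) (hg1 : ∀ x, ‖g x‖ ≤ 1) (hg' : Measurable g')
        (hg1' : ∀ x, ‖g' x‖ ≤ 1) :
        inner ℂ ((hmem hg hg1).toLp g) ((hmem hg' hg1').toLp g') =
          ∫ x, g' x * starRingEnd ℂ (g x) ∂μ := by
      rw [L2.inner_def]
      refine integral_congr_ae ?_
      filter_upwards [(hmem hg hg1).coeFn_toLp, (hmem hg' hg1').coeFn_toLp] with x hx hx'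
      rw [hx, hx', RCLike.inner_apply]
    let U (n : ℕ) : Lp ℂ 2 μ := (hmem (hum n) (hu1 n)).toLp (u n)
    have hU : Tendsto (fun N : ℕ => ‖∑ n ∈ range N, U n‖ / N) atTop (𝓝 0) := by
      refine tendsto_norm_sum_range_div_of_inner (fun n => hnorm (hum n) (hu1 n)) fun h h' hne => ?_
      have hcoeff : Irrational ((taylor (h' : ℝ) p - taylor (h : ℝ) p).coeff (j + 1)) := by
        rw [coeff_taylor_sub_taylor hp]
        have hz : ((j + 1 + 1 : ℕ) * ((h' : ℤ) - h) : ℤ) ≠ 0 := by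
          refine mul_ne_zero (by positivity) (sub_ne_zero.2 ?_)
          exact_mod_cast hne.symm
        convert hirr.intCast_mul hz using 1
        push_cast
        ring
      refine (ih _ (natDegree_taylor_sub_taylor_le hp _ _) hcoeff
        (fun i x => f (i + 1) (T^[(i + 1) * h'] x) *
          starRingEnd ℂ (f (i + 1) (T^[(i + 1) * h] x))) (fun i => ?_) fun i x => ?_).congr
        fun N => ?_
      · exact ((hf _).comp (hT.iterate _).measurable).mul
          (continuous_star.measurable.comp ((hf _).comp (hT.iterate _).measurable))
      · rw [norm_mul, RCLike.norm_conj]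
        exact mul_le_one₀ (hf1 _ _) (norm_nonneg _) (hf1 _ _)
      · congr 1
        refine sum_congr rfl fun n _ => ?_
        rw [hinner (hum (n + h)) (hu1 (n + h)) (hum (n + h')) (hu1 (n + h')),
          ← integral_const_mul]
        conv_lhs => rw [← (hT.iterate n).map_eq]
        rw [integral_map (hT.iterate n).measurable.aemeasurable]
        · refine integral_congr_ae (ae_of_all _ fun x => ?_)
          have hsh (i m : ℕ) : T^[(i + 1) * m] (T^[i * n] (T^[n] x)) =
              T^[(i + 1) * (n + m)] x := by
            rw [← iterate_add_apply, ← iterate_add_apply]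
            congr 2
            ring
          simp only [u, hsh, prod_mul_distrib, map_mul, map_prod]
          rw [eval_sub, taylor_eval, taylor_eval, sub_eq_add_neg, AddChar.map_add_eq_mul,
            AddChar.map_neg_eq_inv, Circle.coe_mul, Circle.coe_inv_eq_conj]
          push_cast
          ring
        · refine Measurable.aestronglyMeasurable (measurable_const.mul
            (Finset.measurable_fun_prod _ fun i _ => ?_))
          exact (((hf _).comp (hT.iterate _).measurable).mul
            (continuous_star.measurable.comp ((hf _).comp (hT.iterate _).measurable))).comp
            (hT.iterate _).measurable
    have hf0m : Measurable fun x => starRingEnd ℂ (f 0 x) := continuous_star.measurable.comp (hf 0)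
    have hf01 (x : X) : ‖starRingEnd ℂ (f 0 x)‖ ≤ 1 := (RCLike.norm_conj _).trans_le (hf1 0 x)
    refine squeeze_zero_norm (fun N => ?_) hU
    have hsum : ∑ n ∈ range N, (Real.fourierChar (p.eval (n : ℝ)) : ℂ) *
        ∫ x, ∏ i ∈ range (j + 1 + 1), f i (T^[i * n] x) ∂μ =
        inner ℂ ((hmem hf0m hf01).toLp _) (∑ n ∈ range N, U n) := by
      rw [inner_sum]
      refine sum_congr rfl fun n _ => ?_
      rw [hinner hf0m hf01 (hum n) (hu1 n), ← integral_const_mul]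
      refine integral_congr_ae (ae_of_all _ fun x => ?_)
      simp only [u, prod_range_succ' _ (j + 1), Complex.conj_conj, zero_mul, iterate_zero, id]
      ring
    rw [hsum, norm_div, Complex.norm_natCast]
    gcongr
    refine (norm_inner_le_norm _ _).trans ?_
    exact mul_le_of_le_one_left (norm_nonneg _) (hnorm hf0m hf01)

/-- The averages of multiple correlations of a set of positive measure do not tend to zero. -/
theorem not_tendsto_sum_measureReal_iInter_div {X : Type} [MeasurableSpace X] {μ : Measure X}
    [IsProbabilityMeasure μ] {T : X → X} (hT : MeasurePreserving T μ μ) {A : Set X}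
    (hA : MeasurableSet A) (hμA : 0 < μ A) (k : ℕ) :
    ¬ Tendsto (fun N : ℕ => (∑ n ∈ range N,
      μ.real (⋂ i ∈ range (k + 1), T^[i * n] ⁻¹' A)) / (N : ℝ)) atTop (𝓝 0) := by
  intro hlim
  set c : ℕ → ℝ := fun n => μ.real (⋂ i ∈ range (k + 1), T^[i * n] ⁻¹' A) with hc
  have hc0 (n : ℕ) : 0 ≤ c n := measureReal_nonneg
  have hδ : 0 < μ.real A := ENNReal.toReal_pos hμA.ne' (measure_ne_top _ _)
  obtain ⟨θ, hθ, m, hrec⟩ := exists_le_measureReal_iInter_preimage_iterate k hδ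
  choose r hr hcr using hrec X μ T hT A hA le_rfl
  have hrange (r : ℕ) (hr : r ∈ Icc 1 m) (N : ℕ) :
      ∑ d ∈ range N, c (d * r) ≤ ∑ n ∈ range (m * N + 1), c n := by
    rw [mem_Icc] at hr
    rw [← sum_image (f := c) (g := fun d => d * r)
      fun a _ b _ hab => Nat.eq_of_mul_eq_mul_right hr.1 hab]
    refine sum_le_sum_of_subset_of_nonneg (fun n hn => ?_) fun n _ _ => hc0 n
    obtain ⟨d, hd, rfl⟩ := mem_image.1 hn
    rw [mem_range] at hd ⊢
    have := Nat.mul_le_mul hd.le hr.2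
    rw [mul_comm m]
    lia
  have hlower (N : ℕ) : θ * N ≤ m * ∑ n ∈ range (m * N + 1), c n := by
    calc θ * N = ∑ _d ∈ range N, θ := by simp [mul_comm]
      _ ≤ ∑ d ∈ range N, ∑ r ∈ Icc 1 m, c (d * r) := sum_le_sum fun d _ =>
        (hcr d).trans (single_le_sum (f := fun r => c (d * r)) (fun _ _ => hc0 _) (hr d))
      _ = ∑ r ∈ Icc 1 m, ∑ d ∈ range N, c (d * r) := sum_comm
      _ ≤ ∑ _r ∈ Icc 1 m, ∑ n ∈ range (m * N + 1), c n := sum_le_sum fun r hr => hrange r hr N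
      _ = m * ∑ n ∈ range (m * N + 1), c n := by simp
  have hm : 1 ≤ m := (mem_Icc.1 (hr 0)).1.trans (mem_Icc.1 (hr 0)).2
  have hm0 : (0 : ℝ) < m := by exact_mod_cast hm
  have hε : 0 < θ / (2 * m ^ 2) := by positivity
  obtain ⟨N, hN, hN1⟩ := (((hlim.comp (f := fun N : ℕ => m * N + 1)
    (tendsto_atTop_mono (fun N => (Nat.le_mul_of_pos_left N hm).trans (Nat.le_succ _)) tendsto_id)).eventually
      (gt_mem_nhds hε)).and (eventually_ge_atTop 1)).exists
  have hN0 : (1 : ℝ) ≤ N := by exact_mod_cast hN1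
  have hm1 : (1 : ℝ) ≤ m := by exact_mod_cast hm
  simp only [comp_apply] at hN
  rw [div_lt_iff₀ (by positivity)] at hN
  push_cast at hN
  have h1 := hlower N
  have h2 : (m : ℝ) * (θ / (2 * m ^ 2) * (m * N + 1)) ≤ θ * N := by
    have : (m : ℝ) * (θ / (2 * m ^ 2) * (m * N + 1)) = θ * (m * N + 1) / (2 * m) := by
      field_simp
    rw [this, div_le_iff₀ (by positivity)]
    have := one_le_mul_of_one_le_of_one_le hm1 hN0
    nlinarith [mul_le_mul_of_nonneg_left this hθ.le]
  have h3 := mul_lt_mul_of_pos_left hN hm0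
  linarith

/-- Multiple correlations of a set do not correlate with `cos (2 π β n ^ (j + 1))`. -/
lemma tendsto_sum_cos_mul_measureReal_iInter_div {X : Type*} [MeasurableSpace X] {μ : Measure X}
    [IsProbabilityMeasure μ] {T : X → X} (hT : MeasurePreserving T μ μ) {A : Set X}
    (hA : MeasurableSet A) (j : ℕ) {β : ℝ} (hβ : Irrational β) :
    Tendsto (fun N : ℕ => (∑ n ∈ range N, Real.cos (2 * Real.pi * ((n : ℝ) ^ (j + 1) * β)) *
      μ.real (⋂ i ∈ range (j + 1), T^[i * n] ⁻¹' A)) / (N : ℝ)) atTop (𝓝 0) := by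
  have h := tendsto_sum_fourierChar_mul_integral_div hT j (C β * Polynomial.X ^ (j + 1))
    (natDegree_C_mul_X_pow_le _ _) (by simpa using hβ) (fun _ => A.indicator 1)
    (fun _ => measurable_one.indicator hA) fun _ x => by
      by_cases hx : x ∈ A <;> simp [hx]
  have hre := (Complex.continuous_re.tendsto _).comp h
  rw [Complex.zero_re] at hre
  refine hre.congr fun N => ?_
  have hintegral (n : ℕ) : ∫ x, ∏ i ∈ range (j + 1), A.indicator (1 : X → ℂ) (T^[i * n] x) ∂μ =
      (μ.real (⋂ i ∈ range (j + 1), T^[i * n] ⁻¹' A) : ℂ) := by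
    have hm : MeasurableSet (⋂ i ∈ range (j + 1), T^[i * n] ⁻¹' A) :=
      Finset.measurableSet_biInter _ fun i _ => (hT.iterate _).measurable hA
    have hfun : (fun x => ∏ i ∈ range (j + 1), A.indicator (1 : X → ℂ) (T^[i * n] x)) =
        (⋂ i ∈ range (j + 1), T^[i * n] ⁻¹' A).indicator fun _ => 1 := by
      funext x
      by_cases hx : ∀ i ∈ range (j + 1), T^[i * n] x ∈ A
      · rw [Set.indicator_of_mem (by simpa using hx)]
        exact prod_eq_one fun i hi => by simp [hx i hi]
      · rw [Set.indicator_of_notMem (by simpa using hx)]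
        push Not at hx
        obtain ⟨i, hi, hxi⟩ := hx
        exact prod_eq_zero hi (by simp [hxi])
    rw [hfun, integral_indicator_const _ hm]
    simp
  simp only [comp_apply, hintegral, ← Complex.ofReal_natCast, Complex.div_ofReal_re, Complex.re_sum,
    Complex.re_mul_ofReal]
  congr 1
  refine sum_congr rfl fun n _ => ?_
  congr 1
  rw [Real.fourierChar_apply, Complex.exp_ofReal_mul_I_re]
  rw [eval_mul, eval_C, eval_pow, eval_X, mul_comm β]

lemma cos_two_pi_mul_mem_Icc {t : ℝ} (ht : Int.fract t ∉ Set.Icc (1 / 4 : ℝ) (3 / 4)) :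
    Real.cos (2 * Real.pi * t) ∈ Set.Icc (0 : ℝ) 1 := by
  refine ⟨?_, Real.cos_le_one _⟩
  have hpi := Real.pi_pos
  have h0 := Int.fract_nonneg t
  have h1 := Int.fract_lt_one t
  have hcos : Real.cos (2 * Real.pi * t) = Real.cos (2 * Real.pi * Int.fract t) := by
    rw [← Real.cos_sub_int_mul_two_pi _ ⌊t⌋, Int.fract]
    ring_nf
  rw [hcos]
  rcases lt_or_ge (Int.fract t) (1 / 4) with h | h
  · refine Real.cos_nonneg_of_mem_Icc ⟨?_, ?_⟩ <;> nlinarith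
  · have h' : 3 / 4 < Int.fract t := not_le.1 fun h' => ht ⟨h, h'⟩
    rw [← Real.cos_sub_two_pi]
    refine Real.cos_nonneg_of_mem_Icc ⟨?_, ?_⟩ <;> nlinarith

end

/-- For `k ≥ 2` and irrational `α`, the set
`S_k = {n : {n^k α} ∈ [1/4, 3/4]}` is a set of `(k-1)`-recurrence. -/
theorem Sk_isSetOfRecurrence (k : ℕ) (hk : 2 ≤ k) (α : ℝ) (hα : Irrational α) :
    IsSetOfKRecurrence (k - 1)
      {n : ℕ | Int.fract ((n : ℝ) ^ k * α) ∈ Set.Icc (1/4 : ℝ) (3/4)} := by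
  obtain ⟨j, rfl⟩ : ∃ j, k = j + 1 := ⟨k - 1, by lia⟩
  intro X _ μ _ T hT A hA hμA
  rw [Nat.add_sub_cancel]
  by_contra! hnull
  refine not_tendsto_sum_measureReal_iInter_div hT hA hμA j ?_
  have h2α : Irrational (2 * α) := by exact_mod_cast hα.natCast_mul two_ne_zero
  have h1 := tendsto_sum_cos_mul_measureReal_iInter_div hT hA j hα
  have h2 := tendsto_sum_cos_mul_measureReal_iInter_div hT hA j h2α
  have h3 := (h1.const_mul 2).sub h2
  rw [mul_zero, sub_zero] at h3
  refine squeeze_zero (fun N => by positivity) (fun N => ?_) h3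
  rw [← mul_div_assoc, ← sub_div, Finset.mul_sum, ← Finset.sum_sub_distrib]
  refine div_le_div_of_nonneg_right (Finset.sum_le_sum fun n _ => ?_) (Nat.cast_nonneg _)
  by_cases hn : Int.fract ((n : ℝ) ^ (j + 1) * α) ∈ Set.Icc (1 / 4 : ℝ) (3 / 4)
  · have hzero : μ.real (⋂ i ∈ Finset.range (j + 1), T^[i * n] ⁻¹' A) = 0 := by
      rw [Measure.real, nonpos_iff_eq_zero.1 (hnull n hn), ENNReal.toReal_zero]
    simp only [hzero, mul_zero, sub_zero, le_refl]
  · obtain ⟨hcos0, hcos1⟩ := cos_two_pi_mul_mem_Icc hn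
    have hdouble : Real.cos (2 * Real.pi * ((n : ℝ) ^ (j + 1) * (2 * α))) =
        2 * Real.cos (2 * Real.pi * ((n : ℝ) ^ (j + 1) * α)) ^ 2 - 1 := by
      rw [← Real.cos_two_mul]
      ring_nf
    have hpos : 0 ≤ μ.real (⋂ i ∈ Finset.range (j + 1), T^[i * n] ⁻¹' A) := measureReal_nonneg
    rw [hdouble]
    nlinarith [mul_nonneg (mul_nonneg hcos0 (sub_nonneg.2 hcos1)) hpos]
end
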